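/- arXiv:2104.12185 — 3 statements merged into one kernel-verified Lean document; each statement's English description precedes it below -/
import Mathlib

section
/- Let n ≥ 3 be a positive integer. Then ω(n) ≤ 1.38402 · log n / log log n, where log denotes the natural logarithm. -/
open Finset in
/-- If every set of `k` primes has product at least `A`, and at most `k` primes are below `q`,
then every set of `k + 1` primes has product at least `A * q`. -/
theorem mul_le_prod_primes_succ {k A q : ℕ}
    (hA : ∀ S : Finset ℕ, (∀ p ∈ S, p.Prime) → S.card = k → A ≤ ∏ p ∈ S, p)
    (hq : Nat.count Nat.Prime q ≤ k)
    (S : Finset ℕ) (hS : ∀ p ∈ S, p.Prime) (hk : S.card = k + 1) : A * q ≤ ∏ p ∈ S, p := by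
  have hex : ∃ m ∈ S, q ≤ m := by
    by_contra! h
    have hsub : S ⊆ (range q).filter Nat.Prime := fun p hp ↦ by
      simpa using ⟨h p hp, hS p hp⟩
    have := card_le_card hsub
    rw [← Nat.count_eq_card_filter_range] at this
    omega
  obtain ⟨m, hm, hqm⟩ := hex
  rw [← prod_erase_mul S _ hm]
  refine Nat.mul_le_mul (hA _ (fun p hp ↦ hS p (mem_of_mem_erase hp)) ?_) hqm
  rw [card_erase_of_mem hm, hk, Nat.add_sub_cancel]

/-- Among any six consecutive integers greater than `3`, at most two are prime. -/
theorem count_prime_add_six_le {m : ℕ} (hm : 4 ≤ m) :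
    Nat.count Nat.Prime (m + 6) ≤ Nat.count Nat.Prime m + 2 := by
  have h2 : ∀ a, 4 ≤ a → a % 2 = 0 → ¬ a.Prime := fun a ha h hp ↦ by
    have := (Nat.prime_dvd_prime_iff_eq Nat.prime_two hp).1 (Nat.dvd_of_mod_eq_zero h)
    omega
  have h3 : ∀ a, 4 ≤ a → a % 3 = 0 → ¬ a.Prime := fun a ha h hp ↦ by
    have := (Nat.prime_dvd_prime_iff_eq Nat.prime_three hp).1 (Nat.dvd_of_mod_eq_zero h)
    omega
  have h1 : ∀ a : ℕ, (if a.Prime then 1 else 0) ≤ 1 := fun a ↦ by split_ifs <;> simp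
  have h0 : ∀ a : ℕ, 4 ≤ a → a % 2 = 0 ∨ a % 3 = 0 → (if a.Prime then 1 else 0) = 0 :=
    fun a ha h ↦ if_neg (h.elim (h2 a ha) (h3 a ha))
  have hcount : Nat.count Nat.Prime (m + 6) = Nat.count Nat.Prime m +
      ∑ i ∈ Finset.range 6, if (m + i).Prime then 1 else 0 := by
    simp only [Finset.sum_range_succ, Finset.sum_range_zero, Nat.count_succ, zero_add,
      ← add_assoc, add_zero]
  simp only [Finset.sum_range_succ, Finset.sum_range_zero] at hcount
  have b0 := h1 (m + 0)
  have b1 := h1 (m + 1)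
  have b2 := h1 (m + 2)
  have b3 := h1 (m + 3)
  have b4 := h1 (m + 4)
  have b5 := h1 (m + 5)
  have c0 := h0 (m + 0) (by omega)
  have c1 := h0 (m + 1) (by omega)
  have c2 := h0 (m + 2) (by omega)
  have c3 := h0 (m + 3) (by omega)
  have c4 := h0 (m + 4) (by omega)
  have c5 := h0 (m + 5) (by omega)
  clear h0 h1 h2 h3
  rw [hcount]
  clear hcount
  generalize (if (m + 0).Prime then 1 else 0) = t0 at *
  generalize (if (m + 1).Prime then 1 else 0) = t1 at *
  generalize (if (m + 2).Prime then 1 else 0) = t2 at *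
  generalize (if (m + 3).Prime then 1 else 0) = t3 at *
  generalize (if (m + 4).Prime then 1 else 0) = t4 at *
  generalize (if (m + 5).Prime then 1 else 0) = t5 at *
  have hmod : m % 6 < 6 := Nat.mod_lt _ (by norm_num)
  interval_cases h : m % 6 <;> omega

theorem three_mul_count_prime_le {m : ℕ} (hm : 38 ≤ m) : 3 * Nat.count Nat.Prime m ≤ m - 1 := by
  induction m using Nat.strong_induction_on with
  | _ m ih =>
    by_cases h : m < 44
    · interval_cases m <;> decide
    · have h1 := ih (m - 6) (by omega) (by omega)
      have h2 := count_prime_add_six_le (m := m - 6) (by omega)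
      rw [Nat.sub_add_cancel (by omega)] at h2
      omega

theorem count_prime_three_mul_le {k : ℕ} (hk : 12 ≤ k) :
    Nat.count Nat.Prime (3 * (k + 1)) ≤ k := by
  have := three_mul_count_prime_le (m := 3 * (k + 1)) (by omega)
  omega

theorem mul_log_le_of_le {k c g x : ℝ} (hk : 0 ≤ k) (hg : Real.exp 1 ≤ g)
    (h : k * Real.log g ≤ c * g) (hx : g ≤ x) : k * Real.log x ≤ c * x := by
  have hg0 : 0 < g := (Real.exp_pos 1).trans_le hg
  have hx0 : 0 < x := hg0.trans_le hx
  have h1 : Real.log x / x ≤ Real.log g / g :=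
    Real.log_div_self_antitoneOn (Set.mem_Ici.2 hg) (Set.mem_Ici.2 (hg.trans hx)) hx
  rw [← div_le_iff₀ hx0, mul_div_assoc]
  rw [← div_le_iff₀ hg0, mul_div_assoc] at h
  exact (mul_le_mul_of_nonneg_left h1 hk).trans h

/-- Rational certificate for `k * log x ≤ c * x` on `x ≥ log N`: the point `a / b` lies below
`log N`, and `log (a / b) ≤ P / q ≤ c * (a / b) / k`. -/
theorem mul_log_le_of_certificate {k c x : ℝ} {N a b P q : ℕ} (hk : 0 ≤ k) (hb : 0 < b)
    (hq : 0 < q) (hN : 0 < N) (ha : (2.7182818286 : ℝ) ≤ a / b)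
    (h1 : (2.7182818286 : ℝ) ^ a ≤ (N : ℝ) ^ b)
    (h2 : ((a : ℝ) / b) ^ q ≤ (2.7182818283 : ℝ) ^ P)
    (h3 : k * ((P : ℝ) / q) ≤ c * (a / b)) (hx : Real.log N ≤ x) :
    k * Real.log x ≤ c * x := by
  have hbR : (0 : ℝ) < b := by exact_mod_cast hb
  have hqR : (0 : ℝ) < q := by exact_mod_cast hq
  have hNR : (0 : ℝ) < N := by exact_mod_cast hN
  have hg0 : (0 : ℝ) < (a : ℝ) / b := by linarith
  refine mul_log_le_of_le hk (Real.exp_one_lt_d9.le.trans ha) ?_ (le_trans ?_ hx)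
  · refine le_trans (mul_le_mul_of_nonneg_left ?_ hk) h3
    rw [le_div_iff₀' hqR, ← Real.log_pow, Real.log_le_iff_le_exp (by positivity)]
    refine h2.trans ?_
    rw [← Real.exp_one_pow]
    exact pow_le_pow_left₀ (by norm_num) Real.exp_one_gt_d9.le _
  · rw [div_le_iff₀' hbR, ← Real.log_pow, Real.le_log_iff_exp_le (by positivity)]
    refine le_trans ?_ h1
    rw [← Real.exp_one_pow]
    exact pow_le_pow_left₀ (Real.exp_pos 1).le Real.exp_one_lt_d9.le _

theorem mul_log_sub_one_succ_le {k : ℝ} (hk : 0 < k) :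
    (k + 1) * (Real.log (8 / 3 * (k + 1)) - 1) ≤
      k * (Real.log (8 / 3 * k) - 1) + Real.log (3 * (k + 1)) := by
  have h1 : Real.log (8 / 3 * (k + 1)) ≤ Real.log (3 * (k + 1)) :=
    Real.log_le_log (by positivity) (by linarith)
  have h2 : Real.log ((k + 1) / k) ≤ (k + 1) / k - 1 :=
    Real.log_le_sub_one_of_pos (by positivity)
  have h3 : Real.log ((k + 1) / k) = Real.log (8 / 3 * (k + 1)) - Real.log (8 / 3 * k) := by
    rw [← Real.log_div (by positivity) (by positivity)]
    congr 1
    field_simp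
  have h4 : k * ((k + 1) / k - 1) = 1 := by field_simp; ring
  have h5 := mul_le_mul_of_nonneg_left h2 hk.le
  rw [h3, h4] at h5
  linarith

/-- The product of the first `k` primes for `4 ≤ k ≤ 12` is minimal among products of `k`
primes. -/
theorem le_prod_primes_of_card (S : Finset ℕ) (hS : ∀ p ∈ S, p.Prime) :
    (S.card = 4 → 210 ≤ ∏ p ∈ S, p) ∧ (S.card = 5 → 2310 ≤ ∏ p ∈ S, p) ∧
    (S.card = 6 → 30030 ≤ ∏ p ∈ S, p) ∧ (S.card = 7 → 510510 ≤ ∏ p ∈ S, p) ∧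
    (S.card = 8 → 9699690 ≤ ∏ p ∈ S, p) ∧ (S.card = 9 → 223092870 ≤ ∏ p ∈ S, p) ∧
    (S.card = 10 → 6469693230 ≤ ∏ p ∈ S, p) ∧ (S.card = 11 → 200560490130 ≤ ∏ p ∈ S, p) ∧
    (S.card = 12 → 7420738134810 ≤ ∏ p ∈ S, p) := by
  have h0 : ∀ S : Finset ℕ, (∀ p ∈ S, p.Prime) → S.card = 0 → 1 ≤ ∏ p ∈ S, p :=
    fun S hS _ ↦ Finset.prod_pos fun p hp ↦ (hS p hp).pos
  have h1 := mul_le_prod_primes_succ (q := 2) h0 (by decide)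
  have h2 := mul_le_prod_primes_succ (q := 3) h1 (by decide)
  have h3 := mul_le_prod_primes_succ (q := 5) h2 (by decide)
  have h4 := mul_le_prod_primes_succ (q := 7) h3 (by decide)
  have h5 := mul_le_prod_primes_succ (q := 11) h4 (by decide)
  have h6 := mul_le_prod_primes_succ (q := 13) h5 (by decide)
  have h7 := mul_le_prod_primes_succ (q := 17) h6 (by decide)
  have h8 := mul_le_prod_primes_succ (q := 19) h7 (by decide)
  have h9 := mul_le_prod_primes_succ (q := 23) h8 (by decide)
  have h10 := mul_le_prod_primes_succ (q := 29) h9 (by decide)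
  have h11 := mul_le_prod_primes_succ (q := 31) h10 (by decide)
  have h12 := mul_le_prod_primes_succ (q := 37) h11 (by decide)
  exact ⟨h4 S hS, h5 S hS, h6 S hS, h7 S hS, h8 S hS, h9 S hS, h10 S hS, h11 S hS, h12 S hS⟩

/-- The largest of `k > 12` primes is at least `3 * k`, hence a product of `k` primes is bounded
below by the product of the first twelve primes times `∏ 12 < i ≤ k, 3 * i`. -/
theorem prod_three_mul_le_prod_primes {k : ℕ} (hk : 12 ≤ k) :
    ∀ S : Finset ℕ, (∀ p ∈ S, p.Prime) → S.card = k →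
      7420738134810 * ∏ i ∈ Finset.Ico 12 k, (3 * (i + 1)) ≤ ∏ p ∈ S, p := by
  induction k, hk using Nat.le_induction with
  | base =>
    intro S hS h
    simpa using (le_prod_primes_of_card S hS).2.2.2.2.2.2.2.2 h
  | succ k hk ih =>
    intro S hS h
    rw [Finset.prod_Ico_succ_top hk, ← mul_assoc]
    exact mul_le_prod_primes_succ ih (count_prime_three_mul_le hk) S hS h

theorem mul_log_sub_one_le_log_prod {k : ℕ} (hk : 12 ≤ k) :
    (k : ℝ) * (Real.log (8 / 3 * k) - 1) ≤
      Real.log ((7420738134810 * ∏ i ∈ Finset.Ico 12 k, (3 * (i + 1)) : ℕ) : ℝ) := by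
  induction k, hk using Nat.le_induction with
  | base =>
    have h1 : (8 / 3 * ((12 : ℕ) : ℝ)) = 2 ^ 5 := by norm_num
    rw [h1, Real.log_pow, Real.le_log_iff_exp_le (by norm_num)]
    have h2 : ((12 : ℕ) : ℝ) * (((5 : ℕ) : ℝ) * Real.log 2 - 1) =
        Real.log (2 ^ 60) - (12 : ℕ) := by
      rw [Real.log_pow]; push_cast; ring
    rw [h2, Real.exp_sub, Real.exp_log (by positivity), ← Real.exp_one_pow,
      div_le_iff₀ (by positivity)]
    calc (2 : ℝ) ^ 60 ≤ 7420738134810 * (2.7182818283 : ℝ) ^ 12 := by norm_num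
      _ ≤ 7420738134810 * Real.exp 1 ^ 12 := by
        gcongr
        exact Real.exp_one_gt_d9.le
      _ = _ := by norm_num
  | succ k hk ih =>
    have hk0 : (0 : ℝ) < k := by exact_mod_cast (by omega : 0 < k)
    rw [Finset.prod_Ico_succ_top hk, ← mul_assoc, Nat.cast_mul (_ * _),
      Real.log_mul (x := Nat.cast _)]
    · push_cast at ih ⊢
      linarith [mul_log_sub_one_succ_le hk0]
    · have : 0 < ∏ i ∈ Finset.Ico 12 k, (3 * (i + 1)) := Finset.prod_pos fun i _ ↦ by positivity
      positivity
    · positivity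

theorem mul_log_le_of_twelve_le {k : ℕ} (hk : 12 ≤ k) {x : ℝ}
    (hx : (k : ℝ) * (Real.log (8 / 3 * k) - 1) ≤ x) : k * Real.log x ≤ 1.38402 * x := by
  have hkR : (12 : ℝ) ≤ k := by exact_mod_cast hk
  set L := Real.log (8 / 3 * k) - 1 with hL
  have hL1 : 1 ≤ L := by
    have : Real.log (2 ^ 3) ≤ Real.log (8 / 3 * k) :=
      Real.log_le_log (by norm_num) (by linarith)
    rw [Real.log_pow] at this
    have := Real.log_two_gt_d9
    push_cast at *
    linarith
  refine mul_log_le_of_le (by positivity) ?_ ?_ hx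
  · nlinarith [Real.exp_one_lt_three]
  · have h1 : Real.log (8 / 3 * k) = Real.log (8 / 3) + Real.log k :=
      Real.log_mul (by norm_num) (by positivity)
    have h2 : Real.log (0.38402 * L) ≤ 0.38402 * L - 1 :=
      Real.log_le_sub_one_of_pos (by positivity)
    rw [Real.log_mul (by norm_num) (by positivity)] at h2
    have h3 : 0 ≤ Real.log (8 / 3 * 0.38402) := Real.log_nonneg (by norm_num)
    rw [Real.log_mul (by norm_num) (by norm_num)] at h3
    rw [Real.log_mul (by positivity) (by positivity), mul_left_comm]
    refine mul_le_mul_of_nonneg_left ?_ (by positivity)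
    linarith

theorem mul_log_le_of_le_three {k x : ℝ} (hk : k ≤ 3) (hx : 1 < x) :
    k * Real.log x ≤ 1.38402 * x := by
  have h0 : 0 ≤ Real.log x := Real.log_nonneg hx.le
  have h1 : Real.log (x / Real.exp 1) ≤ x / Real.exp 1 - 1 :=
    Real.log_le_sub_one_of_pos (by positivity)
  rw [Real.log_div (by positivity) (by positivity), Real.log_exp] at h1
  have h2 : x / Real.exp 1 ≤ x / (5 / 2) :=
    div_le_div_of_nonneg_left (by positivity) (by norm_num)
      (by linarith [Real.exp_one_gt_d9])
  have h3 : k * Real.log x ≤ 3 * Real.log x := mul_le_mul_of_nonneg_right hk h0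
  linarith

set_option exponentiation.threshold 4000 in
theorem robin_omega_bound {n : ℕ} (hn : 3 ≤ n) :
    (n.primeFactors.card : ℝ) ≤ 1.38402 * Real.log n / Real.log (Real.log n) := by
  have hx : 1 < Real.log n := by
    rw [Real.lt_log_iff_exp_lt (by positivity)]
    exact Real.exp_one_lt_three.trans_le (by exact_mod_cast hn)
  rw [le_div_iff₀ (Real.log_pos hx)]
  have hS : ∀ p ∈ n.primeFactors, p.Prime := fun p ↦ Nat.prime_of_mem_primeFactors
  have hle : ∏ p ∈ n.primeFactors, p ≤ n :=
    Nat.le_of_dvd (by omega) (Nat.prod_primeFactors_dvd n)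
  have hlog : ∀ N : ℕ, 0 < N → N ≤ ∏ p ∈ n.primeFactors, p → Real.log N ≤ Real.log n :=
    fun N hN h ↦ Real.log_le_log (by exact_mod_cast hN) (by exact_mod_cast h.trans hle)
  obtain ⟨h4, h5, h6, h7, h8, h9, h10, h11, -⟩ := le_prod_primes_of_card n.primeFactors hS
  have hbig := fun hk : 12 ≤ n.primeFactors.card ↦ mul_log_le_of_twelve_le hk
    ((mul_log_sub_one_le_log_prod hk).trans (hlog _
      (Nat.mul_pos (by norm_num) (Finset.prod_pos fun i _ ↦ by positivity))
      (prod_three_mul_le_prod_primes hk _ hS rfl)))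
  generalize n.primeFactors.card = k at *
  rcases le_or_gt k 3 with hk | hk
  · exact mul_log_le_of_le_three (by exact_mod_cast hk) hx
  rcases le_or_gt 12 k with hk' | hk'
  · exact hbig hk'
  interval_cases k
  · exact mul_log_le_of_certificate (a := 5) (b := 1) (P := 5) (q := 3) (by norm_num)
      (by norm_num) (by norm_num) (by norm_num) (by norm_num) (by norm_num) (by norm_num)
      (by norm_num) (hlog _ (by norm_num) (h4 rfl))
  · exact mul_log_le_of_certificate (a := 15) (b := 2) (P := 29) (q := 14) (by norm_num)
      (by norm_num) (by norm_num) (by norm_num) (by norm_num) (by norm_num) (by norm_num)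
      (by norm_num) (hlog _ (by norm_num) (h5 rfl))
  · exact mul_log_le_of_certificate (a := 10) (b := 1) (P := 53) (q := 23) (by norm_num)
      (by norm_num) (by norm_num) (by norm_num) (by norm_num) (by norm_num) (by norm_num)
      (by norm_num) (hlog _ (by norm_num) (h6 rfl))
  · exact mul_log_le_of_certificate (a := 13) (b := 1) (P := 59) (q := 23) (by norm_num)
      (by norm_num) (by norm_num) (by norm_num) (by norm_num) (by norm_num) (by norm_num)
      (by norm_num) (hlog _ (by norm_num) (h7 rfl))
  · exact mul_log_le_of_certificate (a := 193) (b := 12) (P := 89) (q := 32) (by norm_num)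
      (by norm_num) (by norm_num) (by norm_num) (by norm_num) (by norm_num) (by norm_num)
      (by norm_num) (hlog _ (by norm_num) (h8 rfl))
  · exact mul_log_le_of_certificate (a := 2499) (b := 130) (P := 943) (q := 319) (by norm_num)
      (by norm_num) (by norm_num) (by norm_num) (by norm_num) (by norm_num) (by norm_num)
      (by norm_num) (hlog _ (by norm_num) (h9 rfl))
  · exact mul_log_le_of_certificate (a := 45) (b := 2) (P := 137) (q := 44) (by norm_num)
      (by norm_num) (by norm_num) (by norm_num) (by norm_num) (by norm_num) (by norm_num)
      (by norm_num) (hlog _ (by norm_num) (h10 rfl))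
  · exact mul_log_le_of_certificate (a := 26) (b := 1) (P := 49) (q := 15) (by norm_num)
      (by norm_num) (by norm_num) (by norm_num) (by norm_num) (by norm_num) (by norm_num)
      (by norm_num) (hlog _ (by norm_num) (h11 rfl))
end

section
/- Let q ≥ 5 be a prime power, F_q the finite field with q elements, k a positive divisor of q-1 with k ≥ 2, and f(x) = ax² + bx + c ∈ F_q[x] a quadratic polynomial (a ≠ 0) with b² - 4ac ≠ 0. Let N(q-1, k) be the number of primitive elements g of F_q with f(g) ∈ F_q^{×k}. Then (k(q-1)/φ(q-1)) · N(q-1, k) ≥ q - 2k W(q-1) q^{1/2}, where φ is Euler's totient function. -/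
open scoped Classical

/-- `g` is a primitive element of the finite field `F`, i.e. a generator of `Fˣ`. -/
def IsPrimitiveElement {F : Type*} [Field F] [Fintype F] (g : F) : Prop :=
  ∀ y : F, y ≠ 0 → ∃ n : ℕ, g ^ n = y

/-- `x` is `t`-free: `x ≠ 0` and `x = y ^ d` with `d ∣ t`, `d > 0` forces `d = 1`. -/
def IsTFree {F : Type*} [Field F] (t : ℕ) (x : F) : Prop :=
  x ≠ 0 ∧ ∀ d : ℕ, 0 < d → d ∣ t → (∃ y : F, y ^ d = x) → d = 1

/-- `N(t, k)`: the number of `t`-free `x ∈ F` with `f(x) = a x² + b x + c` a nonzero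
`k`-th power. -/
noncomputable def Ncount (F : Type*) [Field F] [Fintype F] (a b c : F) (t k : ℕ) : ℕ :=
  Nat.card {x : F | IsTFree t x ∧ ∃ y : F, y ≠ 0 ∧ y ^ k = a * x ^ 2 + b * x + c}

/-- `W(n)`: the number of squarefree positive divisors of `n`. -/
noncomputable def Wnum (n : ℕ) : ℕ := (n.divisors.filter Squarefree).card

/-- `Rad(n)`: the product of the distinct primes dividing `n`. -/
noncomputable def rad (n : ℕ) : ℕ := ∏ p ∈ n.primeFactors, p

section CharacterSums

open Polynomial

/-- Constants that stay independent modulo high powers are independent over `p ^ s`-th powers. -/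
theorem PowerSeries.eq_zero_of_sum_mul_pow_eq_zero {k ι : Type*} [Field k] [Fintype ι]
    {p : ℕ} [ExpChar k p] (s : ℕ) (w τ : ι → PowerSeries k) (hw : LinearIndependent k w)
    (hord : ∀ c : ι → k, (∀ n < p ^ s, PowerSeries.coeff n (∑ a, c a • w a) = 0) →
      ∑ a, c a • w a = 0)
    (h : ∑ a, w a * τ a ^ p ^ s = 0) : ∀ a, τ a = 0 := by
  have : ExpChar (PowerSeries k) p :=
    expChar_of_injective_ringHom (PowerSeries.C_injective (R := k)) p
  have hpos : p ^ s ≠ 0 := (pow_pos (expChar_pos k p) s).ne'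
  have key : ∀ i a, PowerSeries.coeff i (τ a) = 0 := by
    intro i
    induction i using Nat.strong_induction_on with
    | _ i ih =>
      have hdiv : ∀ a, ∃ τ' : PowerSeries k, τ a = PowerSeries.X ^ i * τ' := fun a =>
        PowerSeries.X_pow_dvd_iff.2 fun m hm => ih m hm a
      choose τ' hτ' using hdiv
      have h2 : ∑ a, w a * τ' a ^ p ^ s = 0 := by
        have : (PowerSeries.X : PowerSeries k) ^ (i * p ^ s) * ∑ a, w a * τ' a ^ p ^ s = 0 := by
          rw [← h, Finset.mul_sum]
          refine Finset.sum_congr rfl fun a _ => ?_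
          rw [hτ' a, mul_pow, ← pow_mul]; ring
        exact (mul_eq_zero.1 this).resolve_left (pow_ne_zero _ PowerSeries.X_ne_zero)
      have hsplit : ∀ a, ∃ ρ : PowerSeries k,
          τ' a = PowerSeries.C (PowerSeries.constantCoeff (τ' a)) + PowerSeries.X * ρ := by
        intro a
        obtain ⟨ρ, hρ⟩ := PowerSeries.X_dvd_iff (φ := τ' a -
          PowerSeries.C (PowerSeries.constantCoeff (τ' a))) |>.2 (by simp)
        exact ⟨ρ, by rw [← hρ]; ring⟩
      choose ρ hρ using hsplit
      have h3 : ∑ a, (PowerSeries.constantCoeff (τ' a)) ^ p ^ s • w a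
          = -(PowerSeries.X ^ p ^ s * ∑ a, w a * ρ a ^ p ^ s) := by
        rw [eq_neg_iff_add_eq_zero, ← h2, Finset.mul_sum, ← Finset.sum_add_distrib]
        refine Finset.sum_congr rfl fun a _ => ?_
        conv_rhs => rw [hρ a, add_pow_expChar_pow, mul_pow, ← map_pow]
        rw [PowerSeries.smul_eq_C_mul]; ring
      have h4 := hord _ (fun n hn => by
        rw [h3, map_neg, neg_eq_zero]
        exact PowerSeries.X_pow_dvd_iff.1 (dvd_mul_right _ _) n hn)
      intro a
      have h5 := Fintype.linearIndependent_iff.1 hw _ h4 a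
      rw [hτ' a, show i = 0 + i by simp, PowerSeries.coeff_X_pow_mul' ]
      simpa using eq_zero_of_pow_eq_zero h5
  intro a
  ext i
  simpa using key i a

/-- A basis of monomials `y ^ i * z ^ j` (`j < e`), with `z ^ e = g(y)` and `deg g ≤ 2 * e`. -/
structure SuperellipticBasis (k A : Type*) [Field k] [CommRing A] [Algebra k A]
    (e : ℕ) (g : k[X]) where
  y : A
  z : A
  basis : Module.Basis (ℕ × Fin e) k A
  basis_apply : ∀ i j, basis (i, j) = y ^ i * z ^ (j : ℕ)
  z_pow : z ^ e = aeval y g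
  natDegree_le : g.natDegree ≤ 2 * e

namespace SuperellipticBasis

variable {k A : Type*} [Field k] [CommRing A] [Algebra k A] {e : ℕ} {g : k[X]}

/-- Indices of the monomials of weight at most `D`. -/
def index (e D : ℕ) : Finset (ℕ × Fin e) :=
  (Finset.range (D + 1) ×ˢ Finset.univ).filter fun x => x.1 + 2 * (x.2 : ℕ) ≤ D

theorem mem_index {D : ℕ} {x : ℕ × Fin e} : x ∈ index e D ↔ x.1 + 2 * (x.2 : ℕ) ≤ D := by
  simp [index]; omega

theorem card_index (e D : ℕ) : (index e D).card = ∑ j : Fin e, (D + 1 - 2 * (j : ℕ)) := by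
  rw [Finset.card_eq_sum_card_fiberwise (f := Prod.snd) (t := Finset.univ) (by simp)]
  refine Finset.sum_congr rfl fun j _ => ?_
  rw [← Finset.card_range (D + 1 - 2 * (j : ℕ))]
  refine Finset.card_bij' (fun x _ => x.1) (fun i _ => (i, j)) ?_ ?_ ?_ ?_
  · rintro ⟨i, j'⟩ h
    simp [mem_index] at h ⊢
    obtain ⟨h, rfl⟩ := h
    omega
  · intro i h
    simp [mem_index] at h ⊢
    omega
  · rintro ⟨i, j'⟩ h
    simp at h ⊢
    exact h.2.symm
  · intros; rfl

theorem card_index_add (e D E : ℕ) (hE : 2 * e ≤ E) :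
    (index e (E + D)).card = (index e E).card + e * D := by
  rw [card_index, card_index]
  have : ∀ j : Fin e, E + D + 1 - 2 * (j : ℕ) = (E + 1 - 2 * (j : ℕ)) + D := fun j => by omega
  simp [this, Finset.sum_add_distrib]

theorem card_index_le (e D : ℕ) : (index e D).card ≤ e * (D + 1) := by
  rw [card_index]
  refine (Finset.sum_le_sum (g := fun _ => D + 1) fun j _ => by omega).trans ?_
  simp

theorem le_card_index (e D : ℕ) : e * D ≤ (index e D).card + 2 * e * e := by
  rw [card_index]
  have : ∑ _j : Fin e, D ≤ ∑ j : Fin e, ((D + 1 - 2 * (j : ℕ)) + 2 * e) :=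
    Finset.sum_le_sum fun j _ => by omega
  simp [Finset.sum_add_distrib] at this
  linarith [this]

variable (S : SuperellipticBasis k A e g)

/-- The span of the monomials of weight at most `D`. -/
noncomputable def filt (D : ℕ) : Submodule k A :=
  Submodule.span k (S.basis '' (index e D : Set (ℕ × Fin e)))

theorem filt_mono {D E : ℕ} (h : D ≤ E) : S.filt D ≤ S.filt E :=
  Submodule.span_mono (Set.image_mono fun x hx => by
    have := mem_index.1 (Finset.mem_coe.1 hx)
    exact Finset.mem_coe.2 (mem_index.2 (this.trans h)))

theorem basis_mem_filt {D : ℕ} {x : ℕ × Fin e} (h : x ∈ index e D) : S.basis x ∈ S.filt D :=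
  Submodule.subset_span ⟨x, h, rfl⟩

instance finite_filt (D : ℕ) : Module.Finite k (S.filt D) :=
  FiniteDimensional.span_of_finite k ((index e D).finite_toSet.image _)

theorem finrank_filt (D : ℕ) : Module.finrank k (S.filt D) = (index e D).card := by
  have h1 : S.filt D = Submodule.span k (Set.range fun x : index e D => S.basis x) := by
    rw [filt]; congr 1; ext a; simp
  rw [h1, finrank_span_eq_card]
  · simp
  · exact S.basis.linearIndependent.comp _ Subtype.val_injective

theorem exists_mem_filt (a : A) : ∃ D, a ∈ S.filt D := by
  induction S.basis.mem_span a using Submodule.span_induction with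
  | zero => exact ⟨0, zero_mem _⟩
  | add x y _ _ hx hy =>
    obtain ⟨D, hD⟩ := hx
    obtain ⟨E, hE⟩ := hy
    exact ⟨max D E, add_mem (S.filt_mono (le_max_left _ _) hD) (S.filt_mono (le_max_right _ _) hE)⟩
  | smul c x _ hx =>
    obtain ⟨D, hD⟩ := hx
    exact ⟨D, Submodule.smul_mem _ _ hD⟩
  | mem x h =>
    obtain ⟨i, rfl⟩ := h
    exact ⟨_, S.basis_mem_filt (mem_index.2 le_rfl)⟩

theorem monomial_mem_filt {D i j : ℕ} (hj : j < 2 * e) (h : i + 2 * j ≤ D) :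
    S.y ^ i * S.z ^ j ∈ S.filt D := by
  by_cases hje : j < e
  · have := S.basis_mem_filt (x := (i, ⟨j, hje⟩)) (mem_index.2 h)
    rwa [S.basis_apply] at this
  · have hz : S.z ^ j = aeval S.y g * S.z ^ (j - e) := by
      rw [← S.z_pow, ← pow_add]; congr 1; omega
    rw [hz, aeval_eq_sum_range, Finset.sum_mul, Finset.mul_sum]
    refine Submodule.sum_mem _ fun t ht => ?_
    have ht' := Finset.mem_range.1 ht
    have hg := S.natDegree_le
    have := S.basis_mem_filt (D := D) (x := (i + t, ⟨j - e, by omega⟩))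
      (mem_index.2 (by simp only; omega))
    rw [S.basis_apply] at this
    have h2 : S.y ^ i * (g.coeff t • S.y ^ t * S.z ^ (j - e))
        = g.coeff t • (S.y ^ (i + t) * S.z ^ (j - e)) := by
      rw [Algebra.smul_def, Algebra.smul_def, pow_add]; ring
    rw [h2]
    exact Submodule.smul_mem _ _ this

theorem mul_mem_filt {D E : ℕ} {a b : A} (ha : a ∈ S.filt D) (hb : b ∈ S.filt E) :
    a * b ∈ S.filt (D + E) := by
  have h := Submodule.mul_mem_mul ha hb
  rw [filt, filt, Submodule.span_mul_span] at h
  refine Submodule.span_le.2 ?_ h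
  rintro _ ⟨_, ⟨⟨i, j⟩, hx, rfl⟩, _, ⟨⟨i', j'⟩, hy, rfl⟩, rfl⟩
  have hx := mem_index.1 (Finset.mem_coe.1 hx)
  have hy := mem_index.1 (Finset.mem_coe.1 hy)
  simp only [S.basis_apply] at hx hy ⊢
  have : S.y ^ i * S.z ^ (j : ℕ) * (S.y ^ i' * S.z ^ (j' : ℕ))
      = S.y ^ (i + i') * S.z ^ ((j : ℕ) + j') := by ring
  rw [this]
  exact S.monomial_mem_filt (by omega) (by omega)

theorem one_mem_filt (he : 0 < e) (D : ℕ) : (1 : A) ∈ S.filt D := by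
  have := S.monomial_mem_filt (D := D) (i := 0) (j := 0) (by omega) (by omega)
  simpa using this

theorem pow_mem_filt (he : 0 < e) {D : ℕ} {a : A} (ha : a ∈ S.filt D) (n : ℕ) :
    a ^ n ∈ S.filt (D * n) := by
  induction n with
  | zero => simpa using S.one_mem_filt he 0
  | succ n ih => rw [pow_succ, Nat.mul_succ]; exact S.mul_mem_filt ih ha

/-- A quotient space killed by the multiples of a nonzero element of weight at most `D` has
dimension at most `e * D`. -/
theorem finrank_le [IsDomain A] {U : Type*} [AddCommGroup U] [Module k U] [FiniteDimensional k U]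
    {D : ℕ} {w : A} (hw : w ∈ S.filt D) (hw0 : w ≠ 0) (φ : A →ₗ[k] U)
    (hφ : Function.Surjective φ) (hker : ∀ a, φ (w * a) = 0) :
    Module.finrank k U ≤ e * D := by
  let bU := Module.finBasis k U
  choose pre hpre using fun i => hφ (bU i)
  choose d hd using fun i => S.exists_mem_filt (pre i)
  let E := 2 * e + ∑ i, d i
  let ψ : S.filt (E + D) →ₗ[k] U := φ.comp (S.filt (E + D)).subtype
  have hsurj : LinearMap.range ψ = ⊤ := by
    rw [eq_top_iff, ← bU.span_eq, Submodule.span_le]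
    rintro _ ⟨i, rfl⟩
    refine ⟨⟨pre i, S.filt_mono ?_ (hd i)⟩, by simp [ψ, hpre]⟩
    have := Finset.single_le_sum (f := d) (fun _ _ => Nat.zero_le _) (Finset.mem_univ i)
    simp only [E]; omega
  have hrn := LinearMap.finrank_range_add_finrank_ker ψ
  rw [hsurj, finrank_top, S.finrank_filt, card_index_add e D E (by simp only [E]; omega)] at hrn
  let μ : S.filt E →ₗ[k] LinearMap.ker ψ :=
    LinearMap.codRestrict _ (LinearMap.codRestrict _ ((LinearMap.mulLeft k w).comp
      (S.filt E).subtype) fun x => by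
        rw [add_comm]; exact S.mul_mem_filt hw x.2) fun x => by
          simp [ψ, LinearMap.codRestrict_apply, hker]
  have hμ : Function.Injective μ := by
    intro a b hab
    have : w * (a : A) = w * (b : A) :=
      congrArg (fun x : LinearMap.ker ψ => ((x : S.filt (E + D)) : A)) hab
    exact Subtype.ext (mul_left_cancel₀ hw0 this)
  have := LinearMap.finrank_le_finrank_of_injective hμ
  rw [S.finrank_filt] at this
  omega

theorem eq_zero_of_coeff_eq_zero [IsDomain A] (θ : A →ₐ[k] PowerSeries k)
    (hy : θ S.y = PowerSeries.X) {D n : ℕ} (hn : e * D < n) {w : A} (hw : w ∈ S.filt D)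
    (h : ∀ i < n, PowerSeries.coeff i (θ w) = 0) : w = 0 := by
  by_contra hw0
  let φ : A →ₗ[k] (Fin n → k) :=
    LinearMap.pi fun i => (PowerSeries.coeff (i : ℕ)).comp θ.toLinearMap
  have hφ : Function.Surjective φ := by
    intro c
    refine ⟨∑ i, c i • S.y ^ (i : ℕ), ?_⟩
    ext i
    simp [φ, hy, PowerSeries.coeff_X_pow, Fin.val_inj]
  have := S.finrank_le hw hw0 φ hφ (fun a => by
    ext i
    simp only [φ, LinearMap.pi_apply, LinearMap.comp_apply, AlgHom.toLinearMap_apply, map_mul,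
      Pi.zero_apply]
    exact PowerSeries.X_pow_dvd_iff.1 ((PowerSeries.X_pow_dvd_iff.2 h).mul_right _) _ i.2)
  simp at this
  omega


/-- Stepanov's method in Bombieri's form: a bound for the number of points of the curve on which
the `p ^ (2 * s)`-power Frobenius acts as the automorphism `(y, z) ↦ (u * y, v * z)`. -/
theorem card_le [IsAlgClosed k] [IsDomain A] {p : ℕ} [ExpChar k p] (he : 0 < e)
    (θ : A →ₐ[k] PowerSeries k) (hθ : Function.Injective θ) (hy : θ S.y = PowerSeries.X)
    (ev : k × k → (A →ₐ[k] k)) (P : Finset (k × k)) (hev : ∀ x ∈ P, ev x S.y = x.1 ∧ ev x S.z = x.2)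
    (s : ℕ) (u v : k) (hu : u ≠ 0) (hv : v ≠ 0)
    (hP : ∀ x ∈ P, x.1 ^ (p ^ s * p ^ s) = u * x.1 ∧ x.2 ^ (p ^ s * p ^ s) = v * x.2)
    (l m : ℕ) (hl : e * l < p ^ s)
    (hdim : (index e (l * p ^ s + m)).card < (index e l).card * (index e m).card) :
    P.card ≤ e * (l + m * p ^ s) := by
  have : ExpChar A p := expChar_of_injective_algebraMap (algebraMap k A).injective p
  set R := p ^ s with hR
  have hRpos : R ≠ 0 := (pow_pos (expChar_pos k p) s).ne'
  let Θ : (index e l × index e m → k) →ₗ[k] S.filt (l * R + m) :=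
    LinearMap.codRestrict _
      (Fintype.linearCombination k fun x : index e l × index e m =>
        S.basis x.1 ^ R * S.basis x.2) fun c => by
      rw [Fintype.linearCombination_apply]
      exact Submodule.sum_mem _ fun x _ => Submodule.smul_mem _ _
        (S.mul_mem_filt (S.pow_mem_filt he (S.basis_mem_filt x.1.2) R) (S.basis_mem_filt x.2.2))
  obtain ⟨t', ht'mem, ht'0⟩ := (Submodule.ne_bot_iff _).1
    (LinearMap.ker_ne_bot_of_finrank_lt (f := Θ) (by
      rw [S.finrank_filt]; simpa using hdim))
  have ht' : ∑ x : index e l × index e m, t' x • (S.basis x.1 ^ R * S.basis x.2) = 0 := by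
    have := congrArg Subtype.val (LinearMap.mem_ker.1 ht'mem)
    simpa [Θ, Fintype.linearCombination_apply] using this
  have hroot : ∀ x : index e l × index e m, ∃ c : k,
      c ^ (R * R) * (u ^ x.2.1.1 * v ^ (x.2.1.2 : ℕ)) = t' x := by
    intro x
    have hne : u ^ x.2.1.1 * v ^ (x.2.1.2 : ℕ) ≠ 0 :=
      mul_ne_zero (pow_ne_zero _ hu) (pow_ne_zero _ hv)
    obtain ⟨c, hc⟩ := IsAlgClosed.exists_pow_nat_eq (t' x / (u ^ x.2.1.1 * v ^ (x.2.1.2 : ℕ)))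
      (Nat.pos_of_ne_zero (mul_ne_zero hRpos hRpos))
    exact ⟨c, by rw [hc, div_mul_cancel₀ _ hne]⟩
  choose t ht using hroot
  let T : index e l → A := fun a => ∑ b : index e m, t (a, b) • S.basis b
  let Ψ : A := ∑ a : index e l, S.basis a * T a ^ R
  have hTmem : ∀ a, T a ∈ S.filt m := fun a =>
    Submodule.sum_mem _ fun b _ => Submodule.smul_mem _ _ (S.basis_mem_filt b.2)
  have hΨmem : Ψ ∈ S.filt (l + m * R) := Submodule.sum_mem _ fun a _ =>
    S.mul_mem_filt (S.basis_mem_filt a.2) (S.pow_mem_filt he (hTmem a) R)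
  have hΨ0 : Ψ ≠ 0 := by
    intro h0
    have hli : LinearIndependent k fun a : index e l => S.basis a :=
      S.basis.linearIndependent.comp _ Subtype.val_injective
    have hT0 := PowerSeries.eq_zero_of_sum_mul_pow_eq_zero (p := p) s
      (fun a : index e l => θ (S.basis a)) (fun a => θ (T a))
      (hli.map' θ.toLinearMap (LinearMap.ker_eq_bot.2 hθ)) (fun c hc => by
        have h1 : ∑ a, c a • θ (S.basis a) = θ (∑ a, c a • S.basis a) := by simp
        rw [h1] at hc ⊢
        rw [S.eq_zero_of_coeff_eq_zero θ hy hl (Submodule.sum_mem _ fun a _ =>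
          Submodule.smul_mem _ _ (S.basis_mem_filt a.2)) hc, map_zero])
      (by simpa [Ψ] using congrArg θ h0)
    refine ht'0 (funext fun x => ?_)
    have h2 : T x.1 = 0 := hθ (by rw [hT0, map_zero])
    have hli' : LinearIndependent k fun b : index e m => S.basis b :=
      S.basis.linearIndependent.comp _ Subtype.val_injective
    have h3 := Fintype.linearIndependent_iff.1 hli' _ h2 x.2
    rw [← ht x, show t x = 0 from h3, zero_pow (mul_ne_zero hRpos hRpos), zero_mul]
    rfl
  have hvan : ∀ x ∈ P, ev x Ψ = 0 := by
    intro x hx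
    obtain ⟨hey, hez⟩ := hev x hx
    obtain ⟨hPy, hPz⟩ := hP x hx
    have hb : ∀ b : ℕ × Fin e, ev x (S.basis b) = x.1 ^ b.1 * x.2 ^ (b.2 : ℕ) := by
      rintro ⟨i, j⟩
      rw [S.basis_apply, map_mul, map_pow, map_pow, hey, hez]
    refine eq_zero_of_pow_eq_zero (n := R) ?_
    rw [← map_zero (ev x), ← ht', map_sum, map_sum, Fintype.sum_prod_type, hR, sum_pow_char_pow p s]
    refine Finset.sum_congr rfl fun a _ => ?_
    rw [map_mul, mul_pow, map_pow, ← pow_mul, map_sum, ← hR]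
    have : (∑ b : index e m, ev x (t (a, b) • S.basis b)) ^ (R * R)
        = ∑ b : index e m, (ev x (t (a, b) • S.basis b)) ^ (R * R) := by
      rw [hR, ← pow_add, sum_pow_char_pow p]
    rw [this, Finset.mul_sum]
    refine Finset.sum_congr rfl fun b _ => ?_
    rw [← ht (a, b)]
    simp only [map_smul, map_mul, map_pow, smul_eq_mul, hb, mul_pow]
    have h1 : (x.1 ^ b.1.1) ^ (R * R) = (u * x.1) ^ b.1.1 := by
      rw [← pow_mul, mul_comm, pow_mul, hPy]
    have h2 : (x.2 ^ (b.1.2 : ℕ)) ^ (R * R) = (v * x.2) ^ (b.1.2 : ℕ) := by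
      rw [← pow_mul, mul_comm, pow_mul, hPz]
    rw [h1, h2]
    ring
  let φ : A →ₗ[k] (P → k) := LinearMap.pi fun x => (ev x).toLinearMap
  have hinj : Function.Injective fun x : P => (ev x : A →* k) := by
    intro x x' h
    have h1 : ev x S.y = ev x' S.y := DFunLike.congr_fun h S.y
    have h2 : ev x S.z = ev x' S.z := DFunLike.congr_fun h S.z
    rw [(hev x x.2).1, (hev x' x'.2).1] at h1
    rw [(hev x x.2).2, (hev x' x'.2).2] at h2
    exact Subtype.ext (Prod.ext h1 h2)
  have hsurj : Function.Surjective φ := by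
    rw [← LinearMap.range_eq_top]
    by_contra hne
    obtain ⟨χ, hχ0, hχ⟩ := Submodule.exists_le_ker_of_lt_top _ (lt_top_iff_ne_top.2 hne)
    have hdual := (linearIndependent_monoidHom A k).comp _ hinj
    refine hχ0 (LinearMap.pi_ext' fun x => LinearMap.ext_ring ?_)
    have h0 := Fintype.linearIndependent_iff.1 hdual (fun x => χ (Pi.single x 1)) (by
      ext a
      have h1 : χ (φ a) = 0 := LinearMap.mem_ker.1 (hχ ⟨a, rfl⟩)
      rw [LinearMap.pi_apply_eq_sum_univ χ] at h1
      simp only [Finset.sum_apply, Pi.smul_apply, Function.comp, smul_eq_mul, Pi.zero_apply]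
      rw [← h1]
      refine Finset.sum_congr rfl fun x _ => ?_
      rw [smul_eq_mul, mul_comm]
      congr 2
      ext j; simp [Pi.single_apply, eq_comm]) x
    simpa using h0
  have := S.finrank_le hΨmem hΨ0 φ hsurj fun a => by
    ext x
    simp [φ, hvan x x.2]
  simpa using this

end SuperellipticBasis

namespace SuperellipticCurve

variable {k : Type*} [Field k] (e : ℕ) (f : k[X])

/-- The polynomial `Z ^ e - f(Y ^ e)` in `Z` over `k[Y]`. -/
noncomputable def poly : k[X][X] := X ^ e - C (expand k e f)

theorem poly_monic (he : 0 < e) : (poly e f).Monic :=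
  monic_X_pow_sub_C _ he.ne'

theorem natDegree_poly : (poly e f).natDegree = e := natDegree_X_pow_sub_C

theorem poly_irreducible (he : 0 < e) (hek : (e : k) ≠ 0) {ρ : k} (hρ0 : ρ ≠ 0)
    (hρ : f.eval (ρ ^ e) = 0) (hρ' : (derivative f).eval (ρ ^ e) ≠ 0) :
    Irreducible (poly e f) := by
  have hprime : (Ideal.span {X - C ρ} : Ideal k[X]).IsPrime :=
    (Ideal.span_singleton_prime (X_sub_C_ne_zero ρ)).2 (prime_X_sub_C ρ)
  have hdvd : X - C ρ ∣ expand k e f := by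
    rw [dvd_iff_isRoot, IsRoot, expand_eval, hρ]
  have hdeg : (poly e f).degree = e := by
    rw [poly, degree_X_pow_sub_C he]
  refine irreducible_of_eisenstein_criterion (P := Ideal.span {X - C ρ}) hprime ?_ ?_ ?_ ?_
    (poly_monic e f he).isPrimitive
  · rw [(poly_monic e f he).leadingCoeff]
    exact fun h => hprime.ne_top ((Ideal.eq_top_iff_one _).2 h)
  · intro n hn
    rw [hdeg, Nat.cast_lt] at hn
    rw [poly, coeff_sub, coeff_X_pow, if_neg hn.ne, coeff_C, zero_sub, neg_mem_iff]
    split_ifs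
    · exact Ideal.mem_span_singleton.2 hdvd
    · exact zero_mem _
  · rw [hdeg]; exact_mod_cast he
  · rw [Ideal.span_singleton_pow, Ideal.mem_span_singleton, poly, coeff_sub, coeff_X_pow,
      if_neg he.ne, coeff_C_zero, zero_sub, dvd_neg]
    rintro ⟨w, hw⟩
    have h1 := congrArg (fun h => (derivative h).eval ρ) hw
    simp [derivative_expand, expand_eval, derivative_pow, hek, hρ0, hρ'] at h1

theorem exists_powerSeries [IsAlgClosed k] (he : 0 < e) (hek : (e : k) ≠ 0) (hf0 : f.eval 0 ≠ 0) :
    ∃ Z : PowerSeries k, Z ^ e = (expand k e f : k[X]) := by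
  obtain ⟨z₀, hz₀⟩ := IsAlgClosed.exists_pow_nat_eq (f.eval 0) he
  have hz : z₀ ≠ 0 := by
    rintro rfl
    exact hf0 (by rw [← hz₀, zero_pow he.ne'])
  obtain ⟨Z, hZ, -⟩ := HenselianRing.is_henselian
    (I := Ideal.span {(PowerSeries.X : PowerSeries k)})
    (X ^ e - C ((expand k e f : k[X]) : PowerSeries k)) (monic_X_pow_sub_C _ he.ne')
    (PowerSeries.C z₀) (by
      rw [Ideal.mem_span_singleton, PowerSeries.X_dvd_iff]
      simp [hz₀, ← coeff_zero_eq_eval_zero, coeff_expand he])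
    (by
      refine IsUnit.map _ ?_
      rw [PowerSeries.isUnit_iff_constantCoeff]
      simp [derivative_X_pow, hek, hz])
  refine ⟨Z, ?_⟩
  simpa [IsRoot, sub_eq_zero] using hZ

/-- The monomial basis of the coordinate ring of `z ^ e = f(y ^ e)`. -/
noncomputable def superellipticBasis (he : 0 < e) (hf : f.natDegree ≤ 2) :
    SuperellipticBasis k (AdjoinRoot (poly e f)) e (expand k e f) where
  y := algebraMap k[X] _ X
  z := AdjoinRoot.root _
  basis := ((basisMonomials k).smulTower (AdjoinRoot.powerBasis' (poly_monic e f he)).basis).reindex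
    (Equiv.prodCongr (Equiv.refl ℕ) (finCongr (by
      rw [AdjoinRoot.powerBasis'_dim, natDegree_poly])))
  basis_apply i j := by
    simp [Module.Basis.smulTower_apply, Algebra.smul_def, ← X_pow_eq_monomial]
  z_pow := by
    have h : AdjoinRoot.mk (poly e f) (poly e f) = 0 := AdjoinRoot.mk_self
    rw [poly, map_sub, sub_eq_zero, map_pow, AdjoinRoot.mk_X, AdjoinRoot.mk_C] at h
    rw [aeval_algebraMap_apply, aeval_X_left_apply]
    exact h
  natDegree_le := by
    rw [natDegree_expand]
    exact Nat.mul_le_mul_right e hf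

/-- The weighted point count of `SuperellipticBasis.card_le` for `z ^ e = f(y ^ e)`. -/
theorem card_le [IsAlgClosed k] {p : ℕ} [ExpChar k p] (he : 0 < e) (hek : (e : k) ≠ 0)
    (hf : f.natDegree ≤ 2) (hf0 : f.eval 0 ≠ 0) {r : k} (hr : f.eval r = 0)
    (hr' : (derivative f).eval r ≠ 0) (P : Finset (k × k))
    (hcurve : ∀ x ∈ P, x.2 ^ e = f.eval (x.1 ^ e))
    (s : ℕ) (u v : k) (hu : u ≠ 0) (hv : v ≠ 0)
    (hP : ∀ x ∈ P, x.1 ^ (p ^ s * p ^ s) = u * x.1 ∧ x.2 ^ (p ^ s * p ^ s) = v * x.2)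
    (l m : ℕ) (hl : e * l < p ^ s)
    (hdim : (SuperellipticBasis.index e (l * p ^ s + m)).card <
      (SuperellipticBasis.index e l).card * (SuperellipticBasis.index e m).card) :
    P.card ≤ e * (l + m * p ^ s) := by
  obtain ⟨ρ, hρ⟩ := IsAlgClosed.exists_pow_nat_eq r he
  have hρ0 : ρ ≠ 0 := by
    rintro rfl
    rw [zero_pow he.ne'] at hρ
    exact hf0 (hρ ▸ hr)
  have hirr : Irreducible (poly e f) :=
    poly_irreducible e f he hek hρ0 (by rw [hρ, hr]) (by rwa [hρ])
  have : IsDomain (AdjoinRoot (poly e f)) := AdjoinRoot.isDomain_of_prime hirr.prime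
  obtain ⟨Z, hZ⟩ := exists_powerSeries e f he hek hf0
  let θ : AdjoinRoot (poly e f) →ₐ[k] PowerSeries k :=
    AdjoinRoot.liftAlgHom (poly e f) (coeToPowerSeries.algHom k) Z (by
      simp [poly, hZ, coeToPowerSeries.algHom_apply])
  have hθC : ∀ h : k[X], θ (algebraMap k[X] _ h) = (h : PowerSeries k) := by
    intro h
    simp [θ, AdjoinRoot.algebraMap_eq, coeToPowerSeries.algHom_apply]
  have hθ : Function.Injective θ := by
    have : Module.Finite k[X] (AdjoinRoot (poly e f)) := (poly_monic e f he).finite_adjoinRoot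
    refine (RingHom.injective_iff_ker_eq_bot (θ : AdjoinRoot (poly e f) →+* PowerSeries k)).2 ?_
    refine Ideal.eq_bot_of_comap_eq_bot (R := k[X]) ?_
    rw [eq_bot_iff]
    intro h hh
    have h1 : θ (algebraMap k[X] _ h) = 0 := hh
    rw [hθC] at h1
    exact Polynomial.coe_eq_zero_iff.1 h1
  have hevex : ∀ x : k × k, ∃ ev : AdjoinRoot (poly e f) →ₐ[k] k, x ∈ P →
      ev (algebraMap k[X] _ X) = x.1 ∧ ev (AdjoinRoot.root _) = x.2 := by
    intro x
    by_cases hx : x ∈ P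
    · refine ⟨AdjoinRoot.liftAlgHom (poly e f) (aeval x.1) x.2 ?_, fun _ => ⟨?_, ?_⟩⟩
      · simp [poly, hcurve x hx, eval₂_eq_eval_map]
      · simp [AdjoinRoot.algebraMap_eq]
      · simp
    · obtain ⟨z, hz⟩ := IsAlgClosed.exists_pow_nat_eq (f.eval (0 ^ e)) he
      refine ⟨AdjoinRoot.liftAlgHom (poly e f) (aeval 0) z ?_, fun h => absurd h hx⟩
      simp [poly, hz, eval₂_eq_eval_map]
  choose ev hev using hevex
  exact (superellipticBasis e f he hf).card_le he θ hθ (by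
    change θ (algebraMap k[X] _ X) = _
    rw [hθC, Polynomial.coe_X]) ev P hev s u v hu hv hP l m hl hdim

end SuperellipticCurve

/-- Upper bound, of the expected order of magnitude, for the number of `x` such that `x` and `f(x)`
have prescribed `M`-th powers. -/
theorem card_norm_fiber_le {F k : Type*} [Field F] [Fintype F] [Field k] [IsAlgClosed k]
    [Algebra F k] {e : ℕ} (he : Fintype.card F = e + 1) {f : k[X]} (hf : f.natDegree ≤ 2)
    (hf0 : f.eval 0 ≠ 0) {r : k} (hr : f.eval r = 0) (hr' : (derivative f).eval r ≠ 0)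
    {s M R : ℕ} (hR : R = Fintype.card F ^ s) (hM : e * M + 1 = R * R) (hRe : 30 * e ^ 4 ≤ R)
    {u v : k} (hu : u ≠ 0) (hv : v ≠ 0) (T : Finset k)
    (hT : ∀ x ∈ T, x ^ M = u ∧ f.eval x ^ M = v) :
    e ^ 2 * T.card ≤ R * R + e * (4 * e + 3) * R := by
  obtain ⟨p, hchar⟩ := CharP.exists F
  have hp : p.Prime := CharP.char_is_prime F p
  obtain ⟨n, -, hn⟩ := FiniteField.card F p
  have : CharP k p := charP_of_injective_algebraMap (algebraMap F k).injective p
  have : ExpChar k p := ExpChar.prime hp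
  have hcard : 1 < Fintype.card F := Fintype.one_lt_card
  have he0 : 0 < e := by omega
  have hek : (e : k) ≠ 0 := by
    have h1 : ((e + 1 : ℕ) : F) = 0 := by rw [← he, FiniteField.cast_card_eq_zero]
    have h2 : ((e + 1 : ℕ) : k) = 0 := by rw [← map_natCast (algebraMap F k), h1, map_zero]
    intro h
    push_cast at h2
    simp [h] at h2
  have hRp : R = p ^ (n * s) := by rw [hR, hn, pow_mul]
  obtain ⟨l, hl⟩ : e ∣ R - 1 := by
    have := Nat.sub_dvd_pow_sub_pow (Fintype.card F) 1 s
    rwa [he, one_pow, Nat.add_sub_cancel, ← he, ← hR] at this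
  have hR1 : 1 ≤ R := by rw [hR]; exact Nat.one_le_pow _ _ (by omega)
  have hlR : e * l + 1 = R := by omega
  have hM0 : M ≠ 0 := by
    rintro rfl
    have : 1 < R := by nlinarith [Nat.one_le_pow 4 e he0]
    nlinarith
  choose ρ hρ using fun x : k => IsAlgClosed.exists_pow_nat_eq x he0
  have hunit : ∀ ε : Fˣ, (algebraMap F k ε) ^ e = 1 := by
    intro ε
    have h1 := FiniteField.pow_card_sub_one_eq_one (ε : F) ε.ne_zero
    rw [he, Nat.add_sub_cancel] at h1
    rw [← map_pow, h1, map_one]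
  let pt : k × Fˣ × Fˣ → k × k := fun t =>
    (algebraMap F k t.2.1 * ρ t.1, algebraMap F k t.2.2 * ρ (f.eval t.1))
  have hpt : ∀ t, (pt t).1 ^ e = t.1 ∧ (pt t).2 ^ e = f.eval t.1 := fun t => by
    simp [pt, mul_pow, hunit, hρ]
  have hρ0 : ∀ x, x ≠ 0 → ρ x ≠ 0 := by
    intro x hx h
    have := hρ x
    rw [h, zero_pow he0.ne'] at this
    exact hx this.symm
  let D : Finset (k × Fˣ × Fˣ) := T ×ˢ Finset.univ
  have hinj : Set.InjOn pt D := by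
    rintro ⟨x, a, b⟩ h ⟨x', a', b'⟩ - heq
    have h1 : x = x' := (hpt (x, a, b)).1.symm.trans (heq ▸ (hpt (x', a', b')).1)
    subst h1
    obtain ⟨hx1, hx2⟩ := hT x (by simpa [D] using h)
    have hx0 : x ≠ 0 := by rintro rfl; rw [zero_pow hM0] at hx1; exact hu hx1.symm
    have hfx0 : f.eval x ≠ 0 := by intro h; rw [h, zero_pow hM0] at hx2; exact hv hx2.symm
    simp only [pt, Prod.mk.injEq, mul_eq_mul_right_iff, hρ0 x hx0, hρ0 _ hfx0, or_false,
      (algebraMap F k).injective.eq_iff, Units.val_inj] at heq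
    simp [heq.1, heq.2]
  have hkey := SuperellipticCurve.card_le (p := p) e f he0 hek hf hf0 hr hr' (D.image pt) (by
      intro y hy
      obtain ⟨t, -, rfl⟩ := Finset.mem_image.1 hy
      rw [(hpt t).1, (hpt t).2]) (n * s) u v hu hv (by
      intro y hy
      obtain ⟨t, ht, rfl⟩ := Finset.mem_image.1 hy
      obtain ⟨h1, h2⟩ := hT t.1 (by simpa [D] using ht)
      rw [← hRp, ← hM, pow_succ, pow_mul, pow_succ, pow_mul, (hpt t).1, (hpt t).2, h1, h2]
      exact ⟨rfl, rfl⟩) l (l + (4 * e + 3)) (by rw [← hRp]; omega) (by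
      rw [← hRp]
      have h1 := SuperellipticBasis.card_index_le e (l * R + (l + (4 * e + 3)))
      have h2 := SuperellipticBasis.le_card_index e l
      have h3 := SuperellipticBasis.le_card_index e (l + (4 * e + 3))
      set A := (SuperellipticBasis.index e l).card
      set B := (SuperellipticBasis.index e (l + (4 * e + 3))).card
      refine h1.trans_lt ?_
      have h4 : R ≤ A + 2 * e * e + 1 := by omega
      have h5 : R + 2 * e * e + 3 * e ≤ B + 1 := by nlinarith
      zify at *
      have e1 : (1 : ℤ) ≤ e := by exact_mod_cast he0
      have hA : (0 : ℤ) ≤ R - 1 - 2 * e * e := by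
        nlinarith [pow_le_pow_right₀ e1 (show 2 ≤ 4 by norm_num)]
      have h6 : (R - 1 - 2 * e * e : ℤ) * (R + 2 * e * e + 3 * e - 1) ≤ A * B :=
        mul_le_mul (by linarith) (by linarith) (by nlinarith) (by linarith)
      refine lt_of_lt_of_le ?_ h6
      have h7 : (e : ℤ) * (l * R + (l + (4 * e + 3)) + 1) =
          (R - 1) * R + (R - 1) + 4 * e * e + 4 * e := by
        rw [← hlR]; ring
      rw [h7]
      have e2 : (e : ℤ) ≤ e ^ 4 := le_self_pow₀ e1 (by norm_num)
      have e3 : (e : ℤ) ^ 2 ≤ e ^ 4 := pow_le_pow_right₀ e1 (by norm_num)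
      have e4 : (e : ℤ) ^ 3 ≤ e ^ 4 := pow_le_pow_right₀ e1 (by norm_num)
      nlinarith [mul_nonneg (sub_nonneg.2 e1) (by linarith : (0 : ℤ) ≤ R)])
  rw [Finset.card_image_of_injOn hinj, Finset.card_product, ← hRp] at hkey
  have hcardU : (Finset.univ : Finset (Fˣ × Fˣ)).card = e * e := by
    rw [Finset.card_univ, Fintype.card_prod, Fintype.card_units, he, Nat.add_sub_cancel]
  rw [hcardU] at hkey
  nlinarith

theorem MulChar.norm_apply_le_one {F : Type*} [Field F] [Finite F] (χ : MulChar F ℂ) (x : F) :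
    ‖χ x‖ ≤ 1 := by
  rcases eq_or_ne x 0 with rfl | hx
  · simp
  · have := Fintype.ofFinite F
    refine (Complex.norm_eq_one_of_pow_eq_one (n := Fintype.card F - 1) ?_ ?_).le
    · rw [← map_pow, FiniteField.pow_card_sub_one_eq_one x hx, map_one]
    · have := Fintype.one_lt_card (α := F)
      omega

/-- The character sum of `χ(x) η(f(x))` over the extension `K` of `F`. -/
noncomputable def normCharSum {F : Type*} [Field F] (χ η : MulChar F ℂ) (f : F[X])
    (K : Type*) [Field K] [Fintype K] [Algebra F K] : ℂ :=
  ∑ x : K, χ (Algebra.norm F x) * η (Algebra.norm F (aeval x f))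

/-- A weak bound, of the right order of magnitude, for character sums over even degree
extensions. -/
theorem norm_normCharSum_le {F K k : Type*} [Field F] [Fintype F] [Field k] [IsAlgClosed k]
    [Algebra F k] [Field K] [Fintype K] [Algebra F K] {e : ℕ} (he : Fintype.card F = e + 1)
    {f : F[X]} (hf : f.natDegree ≤ 2) (hf0 : f.eval 0 ≠ 0) {r : k} (hr : aeval r f = 0)
    (hr' : aeval r (derivative f) ≠ 0) {χ η : MulChar F ℂ} (hη : η ≠ 1) {s R : ℕ}
    (hR : R = Fintype.card F ^ s) (hK : Fintype.card K = R * R) (hRe : 30 * e ^ 4 ≤ R) :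
    ‖normCharSum χ η f K‖ ≤ e * (4 * e + 3) * R + 3 := by
  have : FiniteDimensional F K := Module.Finite.of_finite
  have he0 : 0 < e := by have := Fintype.one_lt_card (α := F); omega
  let ι : K →ₐ[F] k := IsAlgClosed.lift
  have hfne : f ≠ 0 := by rintro rfl; simp at hf0
  let M := (Nat.card K - 1) / (Nat.card F - 1)
  have hnorm : ∀ x : K, algebraMap F k (Algebra.norm F x) = ι x ^ M := fun x => by
    rw [← map_pow, ← ι.commutes, FiniteField.algebraMap_norm_eq_pow]
  have hR1 : 1 ≤ R := by rw [hR]; exact Nat.one_le_pow _ _ (by omega)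
  have hM : e * M + 1 = R * R := by
    have hd : e ∣ R * R - 1 := by
      have := Nat.sub_dvd_pow_sub_pow (Fintype.card F) 1 (s + s)
      rwa [he, one_pow, Nat.add_sub_cancel, ← he, pow_add, ← hR] at this
    have h1 : M = (R * R - 1) / e := by
      simp only [M, Nat.card_eq_fintype_card, hK, he, Nat.add_sub_cancel]
    rw [h1, Nat.mul_div_cancel' hd]
    have : 1 ≤ R * R := Nat.mul_pos hR1 hR1
    omega
  let nn : K → F × F := fun x => (Algebra.norm F x, Algebra.norm F (aeval x f))
  let T : F × F → Finset K := fun w => Finset.univ.filter fun x => nn x = w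
  let U : Finset (F × F) := Finset.univ.filter fun w => w.1 ≠ 0 ∧ w.2 ≠ 0
  have hT : ∀ w ∈ U, e ^ 2 * (T w).card ≤ R * R + e * (4 * e + 3) * R := by
    intro w hw
    obtain ⟨hw1, hw2⟩ := (Finset.mem_filter.1 hw).2
    have := card_norm_fiber_le (F := F) (f := f.map (algebraMap F k)) he
      (natDegree_map_le.trans hf) (by
        rw [← map_zero (algebraMap F k), eval_map_apply, map_zero]
        exact (_root_.map_ne_zero _).2 hf0)
      (r := r) (by rwa [eval_map_algebraMap]) (by rwa [derivative_map, eval_map_algebraMap])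
      hR hM hRe (u := algebraMap F k w.1) (v := algebraMap F k w.2)
      (by simpa using hw1) (by simpa using hw2) ((T w).map ⟨ι, ι.injective⟩) (by
        intro y hy
        obtain ⟨x, hx, rfl⟩ := Finset.mem_map.1 hy
        have hx : nn x = w := (Finset.mem_filter.1 hx).2
        rw [← hx]
        simp only [nn, hnorm, Function.Embedding.coeFn_mk, eval_map_algebraMap, aeval_algHom_apply]
        simp)
    rwa [Finset.card_map] at this
  have hUcard : U.card = e ^ 2 := by
    have h1 : U = (Finset.univ.filter fun a : F => a ≠ 0) ×ˢ
        (Finset.univ.filter fun a : F => a ≠ 0) := by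
      ext w; simp [U]
    have h2 : (Finset.univ.filter fun a : F => a ≠ 0).card = e := by
      rw [Finset.filter_ne', Finset.card_erase_of_mem (Finset.mem_univ _), Finset.card_univ, he,
        Nat.add_sub_cancel]
    rw [h1, Finset.card_product, h2, sq]
  have hTsum : R * R ≤ ∑ w ∈ U, (T w).card + 3 := by
    have h1 : ∑ w ∈ U, (T w).card = (Finset.univ.filter fun x : K => nn x ∈ U).card := by
      rw [Finset.card_eq_sum_card_fiberwise (f := nn) (t := U) (by simp [Set.MapsTo])]
      refine Finset.sum_congr rfl fun w hw => ?_
      congr 1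
      ext x
      simp only [T, Finset.mem_filter, Finset.mem_univ, true_and]
      exact ⟨fun h => ⟨h ▸ hw, h⟩, fun h => h.2⟩
    have h2 : (Finset.univ.filter fun x : K => ¬ nn x ∈ U).card ≤ 3 := by
      have hsub : (Finset.univ.filter fun x : K => ¬ nn x ∈ U) ⊆
          insert 0 (f.map (algebraMap F K)).roots.toFinset := by
        intro x hx
        have hx : ¬ (nn x ∈ U) := (Finset.mem_filter.1 hx).2
        simp only [U, nn, Finset.mem_filter, Finset.mem_univ, true_and, ne_eq,
          Algebra.norm_eq_zero_iff, not_and_or, not_not] at hx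
        rw [Finset.mem_insert, Multiset.mem_toFinset, mem_roots_map hfne]
        exact hx
      refine (Finset.card_le_card hsub).trans ((Finset.card_insert_le _ _).trans ?_)
      have h3 := Multiset.toFinset_card_le (f.map (algebraMap F K)).roots
      have h4 := card_roots' (f.map (algebraMap F K))
      have h5 : (f.map (algebraMap F K)).natDegree ≤ f.natDegree := natDegree_map_le
      omega
    have h3 := Finset.card_filter_add_card_filter_not (s := Finset.univ) (fun x : K => nn x ∈ U)
    rw [Finset.card_univ, hK] at h3
    omega
  let B : ℝ := R * R + e * (4 * e + 3) * R
  let c : F × F → ℝ := fun w => B - e ^ 2 * (T w).card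
  have hc : ∀ w ∈ U, 0 ≤ c w := fun w hw => by
    have := hT w hw
    simp only [c, B, sub_nonneg]
    exact_mod_cast this
  have hcsum : ∑ w ∈ U, c w ≤ e ^ 2 * (e * (4 * e + 3) * R + 3) := by
    have h1 : (R * R : ℝ) ≤ ∑ w ∈ U, ((T w).card : ℝ) + 3 := by exact_mod_cast hTsum
    simp only [c, Finset.sum_sub_distrib, Finset.sum_const, nsmul_eq_mul, hUcard, ← Finset.mul_sum]
    push_cast
    rw [← mul_sub]
    refine mul_le_mul_of_nonneg_left ?_ (by positivity)
    simp only [B]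
    linarith
  have hoff : ∀ w : F × F, w ∉ U → χ w.1 * η w.2 = 0 := by
    intro w hw
    simp only [U, Finset.mem_filter, Finset.mem_univ, true_and, not_and_or, not_not] at hw
    rcases hw with h | h <;> simp [h, MulChar.map_zero]
  have hS : normCharSum χ η f K = ∑ w ∈ U, χ w.1 * η w.2 * (T w).card := by
    rw [normCharSum, ← Finset.sum_fiberwise (s := Finset.univ) (g := nn),
      ← Finset.sum_subset (Finset.subset_univ U)]
    · refine Finset.sum_congr rfl fun w _ => ?_
      rw [Finset.sum_congr rfl (g := fun _ => χ w.1 * η w.2), Finset.sum_const, nsmul_eq_mul,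
        mul_comm]
      intro x hx
      rw [← (Finset.mem_filter.1 hx).2]
    · intro w _ hw
      refine Finset.sum_eq_zero fun x hx => ?_
      have := hoff w hw
      rwa [← (Finset.mem_filter.1 hx).2] at this
  have h0 : ∑ w ∈ U, χ w.1 * η w.2 = 0 := by
    rw [Finset.sum_subset (Finset.subset_univ U) fun w _ hw => hoff w hw, Fintype.sum_prod_type]
    simp only [← Finset.mul_sum, MulChar.sum_eq_zero_of_ne_one hη, mul_zero, Finset.sum_const_zero]
  have hfin : (e : ℂ) ^ 2 * normCharSum χ η f K = -∑ w ∈ U, χ w.1 * η w.2 * (c w : ℂ) := by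
    have : ∀ w, χ w.1 * η w.2 * (c w : ℂ)
        = (B : ℂ) * (χ w.1 * η w.2) - (e : ℂ) ^ 2 * (χ w.1 * η w.2 * (T w).card) := fun w => by
      simp only [c]; push_cast; ring
    rw [Finset.sum_congr rfl fun w _ => this w, Finset.sum_sub_distrib, ← Finset.mul_sum, h0,
      ← Finset.mul_sum, ← hS]
    ring
  have hle : (e : ℝ) ^ 2 * ‖normCharSum χ η f K‖ ≤ e ^ 2 * (e * (4 * e + 3) * R + 3) := by
    have h1 : (e : ℝ) ^ 2 * ‖normCharSum χ η f K‖ = ‖(e : ℂ) ^ 2 * normCharSum χ η f K‖ := by simp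
    rw [h1, hfin, norm_neg]
    refine (norm_sum_le _ _).trans (le_trans (Finset.sum_le_sum fun w hw => ?_) hcsum)
    rw [norm_mul, norm_mul, Complex.norm_real, Real.norm_of_nonneg (hc w hw)]
    have h2 : ‖χ w.1‖ * ‖η w.2‖ ≤ 1 :=
      mul_le_one₀ (χ.norm_apply_le_one _) (norm_nonneg _) (η.norm_apply_le_one _)
    nlinarith [hc w hw]
  exact le_of_mul_le_mul_left hle (by positivity)

theorem Polynomial.finite_setOf_natDegree_le (F : Type*) [Field F] [Finite F] (m : ℕ) :
    {h : F[X] | h.natDegree ≤ m}.Finite := by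
  refine Set.Finite.of_injOn (f := fun h (i : Fin (m + 1)) => h.coeff i) (t := Set.univ)
    (fun _ _ => Set.mem_univ _) ?_ Set.finite_univ
  intro g hg h hh heq
  ext i
  rcases Nat.lt_or_ge i (m + 1) with hi | hi
  · exact congrFun heq ⟨i, hi⟩
  · rw [coeff_eq_zero_of_natDegree_lt (lt_of_le_of_lt hg hi),
      coeff_eq_zero_of_natDegree_lt (lt_of_le_of_lt hh hi)]

/-- The monic polynomials of degree `m` over a finite field. -/
noncomputable def monicsOfDegree (F : Type*) [Field F] [Finite F] (m : ℕ) : Finset F[X] :=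
  (finite_setOf_natDegree_le F m).toFinset.filter fun h => h.Monic ∧ h.natDegree = m

/-- The monic irreducible polynomials of degree at most `m` over a finite field. -/
noncomputable def monicIrreducibles (F : Type*) [Field F] [Finite F] (m : ℕ) : Finset F[X] :=
  (finite_setOf_natDegree_le F m).toFinset.filter fun h => h.Monic ∧ Irreducible h

section Newton

variable {F : Type*} [Field F] [Finite F]

theorem mem_monicsOfDegree {m : ℕ} {h : F[X]} :
    h ∈ monicsOfDegree F m ↔ h.Monic ∧ h.natDegree = m := by
  simp only [monicsOfDegree, Finset.mem_filter, Set.Finite.mem_toFinset, Set.mem_ofPred_eq,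
    and_iff_right_iff_imp]
  exact fun h => h.2.le

theorem mem_monicIrreducibles {m : ℕ} {h : F[X]} :
    h ∈ monicIrreducibles F m ↔ h.natDegree ≤ m ∧ h.Monic ∧ Irreducible h := by
  simp [monicIrreducibles]

/-- The `m`-th coefficient of the `L`-function of `Λ`. -/
noncomputable def monicSum (Λ : F[X] → ℂ) (m : ℕ) : ℂ := ∑ h ∈ monicsOfDegree F m, Λ h

/-- The `n`-th coefficient of the logarithmic derivative of the `L`-function of `Λ`. -/
noncomputable def primePowerSum (Λ : F[X] → ℂ) (n : ℕ) : ℂ :=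
  ∑ P ∈ (monicIrreducibles F n).filter fun P => P.natDegree ∣ n,
    P.natDegree * Λ P ^ (n / P.natDegree)

theorem filter_monicIrreducibles {n m : ℕ} (hn : n ≠ 0) (hnm : n ≤ m) :
    (monicIrreducibles F n).filter (fun P => P.natDegree ∣ n)
      = (monicIrreducibles F m).filter fun P => P.natDegree ∣ n := by
  ext P
  simp only [Finset.mem_filter, mem_monicIrreducibles]
  constructor
  · rintro ⟨⟨h1, h2⟩, h3⟩
    exact ⟨⟨h1.trans hnm, h2⟩, h3⟩
  · rintro ⟨⟨h1, h2⟩, h3⟩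
    exact ⟨⟨Nat.le_of_dvd (Nat.pos_of_ne_zero hn) h3, h2⟩, h3⟩

open UniqueFactorizationMonoid in
theorem card_filter_pow_dvd {m : ℕ} {h P : F[X]} (hh : h ∈ monicsOfDegree F m)
    (hP : P ∈ monicIrreducibles F m) :
    ((Finset.Icc 1 m).filter fun n => P.natDegree ∣ n ∧ P ^ (n / P.natDegree) ∣ h).card
      = (normalizedFactors h).count P := by
  obtain ⟨hmon, rfl⟩ := mem_monicsOfDegree.1 hh
  obtain ⟨-, hPm, hPi⟩ := mem_monicIrreducibles.1 hP
  have hd : 0 < P.natDegree := hPi.natDegree_pos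
  have hdvd : ∀ j : ℕ, P ^ j ∣ h ↔ j ≤ (normalizedFactors h).count P := fun j => by
    rw [pow_dvd_iff_le_emultiplicity, emultiplicity_eq_count_normalizedFactors hPi hmon.ne_zero,
      hPm.normalize_eq_self, Nat.cast_le]
  have hbound : ∀ j : ℕ, P ^ j ∣ h → P.natDegree * j ≤ h.natDegree := fun j hj => by
    have := natDegree_le_of_dvd hj hmon.ne_zero
    rwa [natDegree_pow, mul_comm] at this
  rw [← Nat.add_sub_cancel (n := (normalizedFactors h).count P) (m := 1), ← Nat.card_Icc]
  symm
  refine Finset.card_nbij' (fun j => P.natDegree * j) (fun n => n / P.natDegree) ?_ ?_ ?_ ?_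
  · intro j hj
    obtain ⟨h1, h2⟩ := Finset.mem_Icc.1 hj
    have h3 := (hdvd j).2 h2
    simp only [Finset.coe_filter, Set.mem_ofPred_eq, Finset.mem_Icc, Nat.mul_div_cancel_left _ hd]
    exact ⟨⟨Nat.mul_pos hd h1, hbound j h3⟩, dvd_mul_right _ _, h3⟩
  · intro n hn
    simp only [Finset.coe_filter, Set.mem_ofPred_eq, Finset.mem_Icc] at hn
    obtain ⟨⟨h1, h2⟩, h3, h4⟩ := hn
    exact Finset.mem_coe.2 (Finset.mem_Icc.2 ⟨Nat.div_pos (Nat.le_of_dvd h1 h3) hd, (hdvd _).1 h4⟩)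
  · intro j _
    exact Nat.mul_div_cancel_left _ hd
  · intro n hn
    simp only [Finset.coe_filter, Set.mem_ofPred_eq] at hn
    exact Nat.mul_div_cancel' hn.2.1

open UniqueFactorizationMonoid in
theorem sum_natDegree_mul_count {m : ℕ} {h : F[X]} (hh : h ∈ monicsOfDegree F m) :
    ∑ P ∈ monicIrreducibles F m, P.natDegree * (normalizedFactors h).count P = m := by
  obtain ⟨hmon, rfl⟩ := mem_monicsOfDegree.1 hh
  have h1 := leadingCoeff_mul_prod_normalizedFactors h
  rw [hmon.leadingCoeff, C_1, one_mul] at h1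
  conv_rhs => rw [← h1, natDegree_multiset_prod _ (zero_notMem_normalizedFactors _),
    Finset.sum_multiset_map_count]
  symm
  refine (Finset.sum_congr rfl fun P _ => by rw [smul_eq_mul, mul_comm]).trans
    (Finset.sum_subset ?_ ?_)
  · intro P hP
    rw [Multiset.mem_toFinset, Polynomial.mem_normalizedFactors_iff hmon.ne_zero] at hP
    exact mem_monicIrreducibles.2 ⟨natDegree_le_of_dvd hP.2.2 hmon.ne_zero, hP.2.1, hP.1⟩
  · intro P _ hP
    rw [Multiset.mem_toFinset, ← Multiset.count_eq_zero] at hP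
    rw [hP, mul_zero]

variable {Λ : F[X] → ℂ} (hΛ1 : Λ 1 = 1)
  (hΛ : ∀ g h : F[X], g.Monic → h.Monic → Λ (g * h) = Λ g * Λ h)
include hΛ1 hΛ

omit [Finite F] in
theorem multiplicative_pow {P : F[X]} (hP : P.Monic) (j : ℕ) : Λ (P ^ j) = Λ P ^ j := by
  induction j with
  | zero => simpa using hΛ1
  | succ j ih => rw [pow_succ, hΛ _ _ (hP.pow j) hP, ih, pow_succ]

theorem pow_mul_monicSum {m n : ℕ} (hn : n ≤ m) {P : F[X]} (hP : P.Monic)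
    (hd : P.natDegree ∣ n) :
    Λ P ^ (n / P.natDegree) * monicSum Λ (m - n)
      = ∑ h ∈ (monicsOfDegree F m).filter fun h => P ^ (n / P.natDegree) ∣ h, Λ h := by
  set Q := P ^ (n / P.natDegree) with hQ
  have hQm : Q.Monic := hP.pow _
  have hQd : Q.natDegree = n := by rw [hQ, hP.natDegree_pow, Nat.div_mul_cancel hd]
  rw [← multiplicative_pow hΛ1 hΛ hP, monicSum, Finset.mul_sum]
  refine Finset.sum_bij (fun g _ => Q * g) ?_ ?_ ?_ ?_
  · intro g hg
    obtain ⟨hg1, hg2⟩ := mem_monicsOfDegree.1 hg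
    refine Finset.mem_filter.2 ⟨mem_monicsOfDegree.2 ⟨hQm.mul hg1, ?_⟩, dvd_mul_right _ _⟩
    rw [hQm.natDegree_mul hg1, hQd, hg2]
    omega
  · intro g _ g' _ h
    exact mul_left_cancel₀ hQm.ne_zero h
  · intro h hh
    obtain ⟨hh, g, rfl⟩ := Finset.mem_filter.1 hh
    obtain ⟨h1, h2⟩ := mem_monicsOfDegree.1 hh
    have hg := hQm.of_mul_monic_left h1
    refine ⟨g, mem_monicsOfDegree.2 ⟨hg, ?_⟩, rfl⟩
    rw [hQm.natDegree_mul hg, hQd] at h2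
    omega
  · intro g hg
    exact (hΛ _ _ hQm (mem_monicsOfDegree.1 hg).1).symm

/-- Newton's identity between the coefficients of an `L`-function and those of its logarithmic
derivative. -/
theorem natCast_mul_monicSum (m : ℕ) :
    m * monicSum Λ m = ∑ n ∈ Finset.Icc 1 m, primePowerSum Λ n * monicSum Λ (m - n) := by
  have hterm : ∀ n ∈ Finset.Icc 1 m, primePowerSum Λ n * monicSum Λ (m - n)
      = ∑ h ∈ monicsOfDegree F m, ∑ P ∈ monicIrreducibles F m,
        if P.natDegree ∣ n ∧ P ^ (n / P.natDegree) ∣ h then (P.natDegree : ℂ) * Λ h else 0 := by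
    intro n hn
    obtain ⟨h1, h2⟩ := Finset.mem_Icc.1 hn
    rw [primePowerSum, filter_monicIrreducibles (by omega) h2, Finset.sum_mul, Finset.sum_filter,
      Finset.sum_comm]
    refine Finset.sum_congr rfl fun P hP => ?_
    split_ifs with hd
    · rw [mul_assoc, pow_mul_monicSum hΛ1 hΛ h2 (mem_monicIrreducibles.1 hP).2.1 hd,
        Finset.mul_sum, Finset.sum_filter]
      simp only [hd, true_and]
    · simp [hd]
  rw [Finset.sum_congr rfl hterm, Finset.sum_comm, monicSum, Finset.mul_sum]
  refine Finset.sum_congr rfl fun h hh => ?_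
  rw [Finset.sum_comm]
  have : ∀ P ∈ monicIrreducibles F m, (∑ n ∈ Finset.Icc 1 m,
      if P.natDegree ∣ n ∧ P ^ (n / P.natDegree) ∣ h then (P.natDegree : ℂ) * Λ h else 0)
      = ((P.natDegree * (UniqueFactorizationMonoid.normalizedFactors h).count P : ℕ) : ℂ) *
          Λ h := by
    intro P hP
    rw [← Finset.sum_filter, Finset.sum_const, card_filter_pow_dvd hh hP, nsmul_eq_mul]
    push_cast
    ring
  rw [Finset.sum_congr rfl this, ← Finset.sum_mul, ← Nat.cast_sum, sum_natDegree_mul_count hh]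

/-- An `L`-function of degree at most two has a logarithmic derivative whose coefficients are
power sums of two numbers. -/
theorem exists_primePowerSum_eq (hvan : ∀ m, 3 ≤ m → monicSum Λ m = 0) :
    ∃ α β : ℂ, ∀ n, n ≠ 0 → primePowerSum Λ n = -(α ^ n + β ^ n) := by
  have h0 : monicSum Λ 0 = 1 := by
    have : monicsOfDegree F 0 = {1} := by
      ext h
      rw [mem_monicsOfDegree, Finset.mem_singleton]
      exact ⟨fun h => eq_one_of_monic_natDegree_zero h.1 h.2, by rintro rfl; simp⟩
    rw [monicSum, this, Finset.sum_singleton, hΛ1]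
  obtain ⟨z, hz⟩ := IsAlgClosed.exists_pow_nat_eq
    (monicSum Λ 1 ^ 2 - 4 * monicSum Λ 2) (n := 2) (by norm_num)
  set α : ℂ := (-monicSum Λ 1 + z) / 2 with hα
  set β : ℂ := (-monicSum Λ 1 - z) / 2 with hβ
  have hsum : monicSum Λ 1 = -(α + β) := by rw [hα, hβ]; ring
  have hprod : monicSum Λ 2 = α * β := by rw [hα, hβ]; linear_combination (1 / 4 : ℂ) * hz
  have h1 := natCast_mul_monicSum hΛ1 hΛ 1
  have h2 := natCast_mul_monicSum hΛ1 hΛ 2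
  rw [Finset.sum_Icc_succ_top (by norm_num)] at h2
  simp only [Finset.Icc_self, Finset.sum_singleton, Nat.reduceAdd, Nat.reduceSub, h0, Nat.cast_one,
    Nat.cast_ofNat, one_mul, mul_one] at h1 h2
  have hS1 : primePowerSum Λ 1 = -(α + β) := by rw [← h1, hsum]
  have hS2 : primePowerSum Λ 2 = -(α ^ 2 + β ^ 2) := by
    rw [hS1, hsum, hprod] at h2
    linear_combination -h2
  have hrec : ∀ n, primePowerSum Λ (n + 3)
      = (α + β) * primePowerSum Λ (n + 2) - α * β * primePowerSum Λ (n + 1) := by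
    intro n
    have h := natCast_mul_monicSum hΛ1 hΛ (n + 3)
    rw [Finset.sum_Icc_succ_top (by omega), Finset.sum_Icc_succ_top (by omega),
      Finset.sum_Icc_succ_top (by omega), Finset.sum_eq_zero fun j hj => ?_,
      hvan _ (by omega), show n + 3 - (n + 1) = 2 by omega,
      show n + 3 - (n + 1 + 1) = 1 by omega, show n + 3 - (n + 2 + 1) = 0 by omega, h0, hsum,
      hprod] at h
    · linear_combination -h
    · rw [hvan _ (by have := (Finset.mem_Icc.1 hj).2; omega), mul_zero]
  refine ⟨α, β, fun n hn => ?_⟩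
  obtain ⟨n, rfl⟩ := Nat.exists_eq_succ_of_ne_zero hn
  clear hn
  induction n using Nat.strong_induction_on with
  | _ n ih =>
    match n with
    | 0 => simpa using hS1
    | 1 => exact hS2
    | n + 2 =>
      rw [Nat.succ_eq_add_one, hrec, ih n (by omega), ih (n + 1) (by omega)]
      simp only [Nat.succ_eq_add_one]
      ring

end Newton

theorem algebraMap_resultant_eq_prod_aroots {F E : Type*} [Field F] [Field E] [IsAlgClosed E]
    [Algebra F E] {P : F[X]} (hP : P.Monic) (g : F[X]) :
    algebraMap F E (resultant P g) = ((P.aroots E).map fun z => aeval z g).prod := by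
  have h := resultant_eq_prod_eval (P.map (algebraMap F E)) (g.map (algebraMap F E)) g.natDegree
    natDegree_map_le (IsAlgClosed.splits _)
  rw [(hP.map _).leadingCoeff, one_pow, one_mul, natDegree_map, resultant_map_map] at h
  rw [h]
  simp only [eval_map_algebraMap]

open IntermediateField in
/-- The norm of `g(x)` is a power of the resultant of `g` and the minimal polynomial of `x`. -/
theorem norm_aeval_eq_resultant_pow {F K : Type*} [Field F] [Field K] [Finite K] [Algebra F K]
    (x : K) (g : F[X]) :
    Algebra.norm F (aeval x g)
      = resultant (minpoly F x) g ^ (Module.finrank F K / (minpoly F x).natDegree) := by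
  have : FiniteDimensional F K := Module.Finite.of_finite
  have : Finite F := Finite.of_injective _ (algebraMap F K).injective
  have hx : IsIntegral F x := Algebra.IsIntegral.isIntegral x
  have hpos : 0 < (minpoly F x).natDegree := minpoly.natDegree_pos hx
  have hrank : Module.finrank F K / (minpoly F x).natDegree = Module.finrank F⟮x⟯ K := by
    rw [← Module.finrank_mul_finrank F F⟮x⟯ K, adjoin.finrank hx, Nat.mul_div_cancel_left _ hpos]
  have hy : aeval x g = algebraMap F⟮x⟯ K (aeval (AdjoinSimple.gen F x) g) := by
    rw [← aeval_algebraMap_apply, AdjoinSimple.algebraMap_gen]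
  rw [hy, ← Algebra.norm_norm (S := F⟮x⟯), Algebra.norm_algebraMap, map_pow, hrank]
  congr 1
  let E := AlgebraicClosure F
  apply (algebraMap F E).injective
  rw [algebraMap_resultant_eq_prod_aroots (minpoly.monic hx), Algebra.norm_eq_prod_embeddings F E]
  let pb := adjoin.powerBasis hx
  have hgen : pb.gen = AdjoinSimple.gen F x := adjoin.powerBasis_gen hx
  have hmin : minpoly F pb.gen = minpoly F x := by rw [hgen, minpoly_gen]
  rw [@Fintype.prod_equiv (F⟮x⟯ →ₐ[F] E) _ _ _ _ _ pb.liftEquiv'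
    _ (fun z => aeval (z : E) g) ?_]
  · rw [← hmin, Finset.prod_mem_multiset _ _ (fun z : E => aeval z g) fun _ => rfl,
      Finset.prod_eq_multiset_prod, Multiset.toFinset_val, Multiset.dedup_eq_self.mpr]
    exact nodup_roots (Separable.map (Algebra.IsSeparable.isSeparable F _))
  · intro σ
    rw [PowerBasis.liftEquiv'_apply_coe, hgen, aeval_algHom_apply]

/-- The completely multiplicative function on monic polynomials whose prime power sums are the
character sums over extensions of `F`. -/
noncomputable def resultantChar {F : Type*} [Field F] (χ η : MulChar F ℂ) (f : F[X]) (h : F[X]) :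
    ℂ := χ (resultant h X) * η (resultant h f)

theorem resultantChar_one {F : Type*} [Field F] (χ η : MulChar F ℂ) (f : F[X]) :
    resultantChar χ η f 1 = 1 := by
  simp [resultantChar]

theorem resultantChar_mul {F : Type*} [Field F] (χ η : MulChar F ℂ) (f g h : F[X])
    (hg : g.Monic) (hh : h.Monic) :
    resultantChar χ η f (g * h) = resultantChar χ η f g * resultantChar χ η f h := by
  simp only [resultantChar, hg.natDegree_mul hh]
  rw [resultant_mul_left _ _ _ _ le_rfl, resultant_mul_left _ _ _ _ le_rfl, map_mul, map_mul]
  ring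

theorem card_filter_minpoly_eq {F K : Type*} [Field F] [Field K] [Fintype K] [Algebra F K]
    {P : F[X]} (hP : P.Monic) (hPi : Irreducible P) (hd : P.natDegree ∣ Module.finrank F K) :
    (Finset.univ.filter fun x : K => minpoly F x = P).card = P.natDegree := by
  have : FiniteDimensional F K := Module.Finite.of_finite
  have : Finite F := Finite.of_injective _ (algebraMap F K).injective
  have hcard : Nat.card F ^ Module.finrank F K = Fintype.card K := by
    rw [← Nat.card_eq_fintype_card, Module.natCard_eq_pow_finrank (K := F) (V := K)]
  have hdvd := hPi.natDegree_dvd_iff_dvd_X_pow_card_pow_sub_X.1 hd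
  rw [hcard] at hdvd
  have hdvd' := Polynomial.map_dvd (algebraMap F K) hdvd
  rw [Polynomial.map_sub, Polynomial.map_pow, map_X] at hdvd'
  have hsplit : (X ^ Fintype.card K - X : K[X]).Splits :=
    Fintype.card_eq_nat_card (α := K) ▸ Polynomial.splits_X_pow_nat_card_sub_X
  have hne : (X ^ Fintype.card K - X : K[X]) ≠ 0 :=
    FiniteField.X_pow_card_sub_X_ne_zero K Fintype.one_lt_card
  have hs : (P.map (algebraMap F K)).Splits := hsplit.of_dvd hne hdvd'
  have hset : (Finset.univ.filter fun x : K => minpoly F x = P) = (P.aroots K).toFinset := by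
    ext x
    rw [Finset.mem_filter, Multiset.mem_toFinset, mem_aroots]
    simp only [Finset.mem_univ, true_and]
    constructor
    · rintro rfl
      exact ⟨hP.ne_zero, minpoly.aeval F x⟩
    · rintro ⟨-, h⟩
      exact (minpoly.eq_of_irreducible_of_monic hPi h hP).symm
  rw [hset, Multiset.toFinset_card_of_nodup (nodup_roots (Separable.map
    (PerfectField.separable_of_irreducible hPi))),
    ← hs.natDegree_eq_card_roots, natDegree_map]

/-- Grouping the elements of an extension according to their minimal polynomials. -/
theorem normCharSum_eq_primePowerSum {F K : Type*} [Field F] [Finite F] [Field K] [Fintype K]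
    [Algebra F K]
    (χ η : MulChar F ℂ) (f : F[X]) :
    normCharSum χ η f K = primePowerSum (resultantChar χ η f) (Module.finrank F K) := by
  have : FiniteDimensional F K := Module.Finite.of_finite
  set n := Module.finrank F K with hn
  have hint : ∀ x : K, IsIntegral F x := fun x => Algebra.IsIntegral.isIntegral x
  have hterm : ∀ x : K, χ (Algebra.norm F x) * η (Algebra.norm F (aeval x f))
      = resultantChar χ η f (minpoly F x) ^ (n / (minpoly F x).natDegree) := fun x => by
    have h := norm_aeval_eq_resultant_pow (F := F) x X
    rw [aeval_X] at h
    rw [h, norm_aeval_eq_resultant_pow, map_pow, map_pow, ← mul_pow, resultantChar]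
  have hmaps : ∀ x ∈ (Finset.univ : Finset K), minpoly F x ∈
      (monicIrreducibles F n).filter fun P => P.natDegree ∣ n := by
    intro x _
    have hd : (minpoly F x).natDegree ∣ n := minpoly.degree_dvd (hint x)
    exact Finset.mem_filter.2 ⟨mem_monicIrreducibles.2
      ⟨Nat.le_of_dvd Module.finrank_pos hd, minpoly.monic (hint x),
        minpoly.irreducible (hint x)⟩, hd⟩
  rw [normCharSum, primePowerSum, ← Finset.sum_fiberwise_of_maps_to hmaps]
  refine Finset.sum_congr rfl fun P hP => ?_
  obtain ⟨hP, hd⟩ := Finset.mem_filter.1 hP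
  obtain ⟨-, hPm, hPi⟩ := mem_monicIrreducibles.1 hP
  rw [Finset.sum_congr rfl (g := fun _ => resultantChar χ η f P ^ (n / P.natDegree)) fun x hx => by
    rw [hterm, (Finset.mem_filter.1 hx).2], Finset.sum_const, card_filter_minpoly_eq hPm hPi hd,
    nsmul_eq_mul]

/-- A nondegenerate binary quadratic form over a finite field takes a value at which a given
nontrivial character is nontrivial. -/
theorem exists_mulChar_quadForm_ne_one {F : Type*} [Field F] [Fintype F] {B D : F}
    (hdisc : B ^ 2 - 4 * D ≠ 0) {η : MulChar F ℂ} (hη : η ≠ 1) :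
    ∃ s t : F, s ^ 2 - B * s * t + D * t ^ 2 ≠ 0 ∧ η (s ^ 2 - B * s * t + D * t ^ 2) ≠ 1 := by
  obtain ⟨v, hv⟩ := MulChar.ne_one_iff.1 hη
  suffices h : ∃ s t : F, s ^ 2 - B * s * t + D * t ^ 2 = v by
    obtain ⟨s, t, h⟩ := h
    exact ⟨s, t, by rw [h]; exact v.ne_zero, by rwa [h]⟩
  by_cases h2 : ringChar F = 2
  · obtain ⟨s, hs⟩ := FiniteField.isSquare_of_char_two h2 (v : F)
    exact ⟨s, 0, by rw [hs]; ring⟩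
  · have h20 : (2 : F) ≠ 0 := Ring.two_ne_zero h2
    have hlead : D - B ^ 2 / 4 ≠ 0 := fun h => hdisc (by
      have h4 : (4 : F) ≠ 0 := by
        have : (4 : F) = 2 * 2 := by norm_num
        rw [this]
        exact mul_ne_zero h20 h20
      field_simp at h
      linear_combination -h)
    obtain ⟨y, t, hyt⟩ := FiniteField.exists_root_sum_quadratic (R := F)
      (f := X ^ 2 - C (v : F)) (g := C (D - B ^ 2 / 4) * X ^ 2) (by compute_degree!)
      (by compute_degree!) (FiniteField.odd_card_of_char_ne_two h2)
    refine ⟨y + B / 2 * t, t, ?_⟩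
    simp only [eval_sub, eval_pow, eval_X, eval_C, eval_mul] at hyt
    have h4 : (B / 2) ^ 2 = B ^ 2 / 4 := by rw [div_pow]; norm_num
    have h5 : B / 2 * 2 = B := div_mul_cancel₀ _ h20
    linear_combination hyt - t ^ 2 * h4 + (y * t + t ^ 2 * (B / 2)) * h5

theorem sum_mulChar_quadForm_eq_zero {F : Type*} [Field F] [Fintype F] {a b c : F} (ha : a ≠ 0)
    (hdisc : b ^ 2 - 4 * a * c ≠ 0) {η : MulChar F ℂ} (hη : η ≠ 1) :
    ∑ s : F, ∑ t : F, η (a * s ^ 2 - b * s * t + c * t ^ 2) = 0 := by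
  set B := b / a with hB
  set D := c / a with hD
  have hb : b = a * B := by rw [hB]; field_simp
  have hc : c = a * D := by rw [hD]; field_simp
  have hdisc' : B ^ 2 - 4 * D ≠ 0 := fun h => hdisc (by
    rw [hb, hc]; linear_combination a ^ 2 * h)
  obtain ⟨u, w, h0, h1⟩ := exists_mulChar_quadForm_ne_one hdisc' hη
  set n := u ^ 2 - B * u * w + D * w ^ 2 with hn
  have hinj : Function.Injective fun z : F × F =>
      (u * z.1 - w * z.2 * D, u * z.2 + z.1 * w - w * z.2 * B) := by
    rintro ⟨s, t⟩ ⟨s', t'⟩ h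
    obtain ⟨e1, e2⟩ := Prod.mk.inj h
    simp only at e1 e2
    have e3 : n * (s - s') = 0 := by rw [hn]; linear_combination (u - B * w) * e1 + w * D * e2
    have e4 : n * (t - t') = 0 := by rw [hn]; linear_combination u * e2 - w * e1
    rw [mul_eq_zero, or_iff_right h0, sub_eq_zero] at e3 e4
    rw [e3, e4]
  have hsum := Function.Bijective.sum_comp (Finite.injective_iff_bijective.1 hinj)
    fun z : F × F => η (a * z.1 ^ 2 - b * z.1 * z.2 + c * z.2 ^ 2)
  rw [← Fintype.sum_prod_type' (f := fun s t => η (a * s ^ 2 - b * s * t + c * t ^ 2))]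
  set S := ∑ z : F × F, η (a * z.1 ^ 2 - b * z.1 * z.2 + c * z.2 ^ 2) with hS
  have hmul : ∑ z : F × F, η (a * (u * z.1 - w * z.2 * D) ^ 2
      - b * (u * z.1 - w * z.2 * D) * (u * z.2 + z.1 * w - w * z.2 * B)
      + c * (u * z.2 + z.1 * w - w * z.2 * B) ^ 2) = η n * S := by
    rw [hS, Finset.mul_sum]
    refine Finset.sum_congr rfl fun z _ => ?_
    rw [← map_mul]
    congr 1
    rw [hn, hb, hc]
    ring
  have : (η n - 1) * S = 0 := by
    rw [sub_mul, one_mul, sub_eq_zero, ← hmul]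
    exact hsum
  exact (mul_eq_zero.1 this).resolve_left (sub_ne_zero.2 h1)

theorem resultant_linear_quadratic {F : Type*} [Field F] (a b c s t : F) :
    resultant (C s + C t * X) (C a * X ^ 2 + C b * X + C c) 1 2
      = a * s ^ 2 - b * s * t + c * t ^ 2 := by
  rcases eq_or_ne t 0 with rfl | ht
  · rw [C_0, zero_mul, add_zero, resultant_C_left]
    simp
  · have h : C s + C t * X = C t * (X + C (s / t)) := by
      rw [mul_add, ← C_mul, mul_div_cancel₀ _ ht, add_comm]
    rw [h, resultant_C_mul_left, resultant_X_add_C_left _ _ _ (by compute_degree)]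
    simp only [eval_add, eval_mul, eval_C, eval_pow, eval_X]
    field_simp
    ring

/-- The sums of `resultantChar` over monic polynomials are invariant under translation. -/
theorem monicSum_eq_sum_add {F : Type*} [Field F] [Finite F] (Λ : F[X] → ℂ) {m : ℕ} {r : F[X]}
    (hr : r.natDegree < m) : monicSum Λ m = ∑ h ∈ monicsOfDegree F m, Λ (h + r) := by
  have key : ∀ p : F[X], p.natDegree < m → ∀ h ∈ monicsOfDegree F m,
      h + p ∈ monicsOfDegree F m := by
    intro p hp h hh
    obtain ⟨h1, h2⟩ := mem_monicsOfDegree.1 hh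
    have hlt : p.degree < h.degree :=
      degree_lt_degree (by omega)
    exact mem_monicsOfDegree.2 ⟨h1.add_of_left hlt, by
      rw [natDegree_add_eq_left_of_degree_lt hlt, h2]⟩
  rw [monicSum]
  refine Finset.sum_bij' (fun h _ => h + -r) (fun h _ => h + r) (key _ (by rwa [natDegree_neg]))
    (key _ hr) ?_ ?_ ?_
  · simp
  · simp
  · simp

/-- The `L`-function of `resultantChar` has degree at most two. -/
theorem monicSum_resultantChar_eq_zero {F : Type*} [Field F] [Fintype F] {a b c : F} (ha : a ≠ 0)
    (hc : c ≠ 0) (hdisc : b ^ 2 - 4 * a * c ≠ 0) (χ : MulChar F ℂ) {η : MulChar F ℂ} (hη : η ≠ 1)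
    {m : ℕ} (hm : 3 ≤ m) :
    monicSum (resultantChar χ η (C a * X ^ 2 + C b * X + C c)) m = 0 := by
  set f : F[X] := C a * X ^ 2 + C b * X + C c with hf
  have hfd : f.natDegree = 2 := natDegree_quadratic ha
  have hf2 : f.coeff 2 = a := by simp [hf]
  have hf0 : f.eval 0 = c := by simp [hf]
  have hfne : f ≠ 0 := by rintro h; rw [h] at hfd; simp at hfd
  let r : F → F → F → F[X] := fun y s t => C y * f + (C s + C t * X)
  have hlin : ∀ s t : F, (C s + C t * X).natDegree ≤ 1 := fun s t => by compute_degree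
  have hr : ∀ y s t, (r y s t).natDegree < m := fun y s t => by
    have : (r y s t).natDegree ≤ 2 :=
      natDegree_add_le_of_degree_le ((natDegree_C_mul_le _ _).trans hfd.le)
        ((hlin s t).trans (by norm_num))
    omega
  have hsum0 : ∀ h ∈ monicsOfDegree F m,
      ∑ y : F, ∑ s : F, ∑ t : F, resultantChar χ η f (h + r y s t) = 0 := by
    intro h hh
    obtain ⟨h1, h2⟩ := mem_monicsOfDegree.1 hh
    have hval : ∀ y s t, resultantChar χ η f (h + r y s t)
        = χ ((-1) ^ m * (h.eval 0 + y * c + s))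
          * (η (a ^ (m - 1)) * η (a * ((h % f).coeff 0 + s) ^ 2
            - b * ((h % f).coeff 0 + s) * ((h % f).coeff 1 + t)
            + c * ((h % f).coeff 1 + t) ^ 2)) := by
      intro y s t
      have hlt : (r y s t).degree < h.degree :=
        degree_lt_degree (by rw [h2]; exact hr y s t)
      have hd : (h + r y s t).natDegree = m := by
        rw [natDegree_add_eq_left_of_degree_lt hlt, h2]
      have hX : resultant (h + r y s t) X = (-1) ^ m * (h.eval 0 + y * c + s) := by
        rw [hd, natDegree_X]
        have := resultant_X_sub_C_right (h + r y s t) m 0 hd.le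
        rw [C_0, sub_zero] at this
        rw [this]
        simp [r, hf0, add_assoc]
      have hmod : (h % f).natDegree ≤ 1 := by
        have := natDegree_mod_lt h (q := f) (by omega)
        omega
      have hdec : h + r y s t = (C ((h % f).coeff 0 + s) + C ((h % f).coeff 1 + t) * X)
          + f * (h / f + C y) := by
        have e1 := EuclideanDomain.div_add_mod h f
        have e2 := eq_X_add_C_of_natDegree_le_one hmod
        conv_lhs => rw [← e1, e2]
        simp only [r, C_add]
        ring
      have hQ : resultant (h + r y s t) f = a ^ (m - 1) * (a * ((h % f).coeff 0 + s) ^ 2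
            - b * ((h % f).coeff 0 + s) * ((h % f).coeff 1 + t)
            + c * ((h % f).coeff 1 + t) ^ 2) := by
        rw [hd, hfd, hdec, resultant_add_mul_left _ _ _ _ _ ?_ hfd.le]
        · have : m = 1 + (m - 1) := by omega
          rw [this, resultant_add_left_deg _ _ _ _ _ (hlin _ _), resultant_linear_quadratic, hf2,
            pow_mul]
          simp
        · have e1 : (h / f).natDegree + 2 ≤ m := by
            rcases eq_or_ne (h / f) 0 with h0 | h0
            · rw [h0, natDegree_zero]
              omega
            · have e3 := degree_add_div hfne
                (degree_lt_degree (by omega : f.natDegree < h.natDegree)).le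
              rw [← degree_mul] at e3
              have e4 := natDegree_eq_of_degree_eq e3
              rw [natDegree_mul hfne h0] at e4
              omega
          have e2 := natDegree_add_C (p := h / f) (a := y)
          omega
      rw [resultantChar, hX, hQ, map_mul η]
    have hχ : ∀ s, ∑ y : F, χ ((-1) ^ m * (h.eval 0 + y * c + s)) = ∑ y : F, χ y := fun s => by
      have hinj : Function.Injective fun y : F => (-1) ^ m * (h.eval 0 + y * c + s) := by
        intro y z hyz
        have := mul_left_cancel₀ (pow_ne_zero m (neg_ne_zero.2 one_ne_zero)) hyz
        exact mul_right_cancel₀ hc (add_left_cancel (add_right_cancel this))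
      exact (Finite.injective_iff_bijective.1 hinj).sum_comp χ
    rw [Finset.sum_comm]
    simp only [hval, ← Finset.mul_sum, ← Finset.sum_mul, hχ]
    have hshift : ∀ s, ∑ t : F, η (a * ((h % f).coeff 0 + s) ^ 2
          - b * ((h % f).coeff 0 + s) * ((h % f).coeff 1 + t) + c * ((h % f).coeff 1 + t) ^ 2)
        = ∑ t : F, η (a * ((h % f).coeff 0 + s) ^ 2
          - b * ((h % f).coeff 0 + s) * t + c * t ^ 2) := fun s =>
      Equiv.sum_comp (Equiv.addLeft ((h % f).coeff 1)) fun t => η (a * ((h % f).coeff 0 + s) ^ 2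
          - b * ((h % f).coeff 0 + s) * t + c * t ^ 2)
    have hshift' := Equiv.sum_comp (Equiv.addLeft ((h % f).coeff 0))
      fun s => ∑ t : F, η (a * s ^ 2 - b * s * t + c * t ^ 2)
    simp only [Equiv.coe_addLeft] at hshift'
    simp only [hshift, hshift', sum_mulChar_quadForm_eq_zero ha hdisc hη, mul_zero]
  have hq : (Fintype.card F : ℂ) ^ 3 * monicSum (resultantChar χ η f) m = 0 := by
    have : ∑ y : F, ∑ s : F, ∑ t : F, monicSum (resultantChar χ η f) m
        = (Fintype.card F : ℂ) ^ 3 * monicSum (resultantChar χ η f) m := by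
      simp only [Finset.sum_const, Finset.card_univ, nsmul_eq_mul]
      ring
    rw [← this]
    rw [Finset.sum_congr rfl fun y _ => Finset.sum_congr rfl fun s _ =>
      Finset.sum_congr rfl fun t _ => monicSum_eq_sum_add _ (hr y s t)]
    simp only [Finset.sum_comm (s := (Finset.univ : Finset F)) (t := monicsOfDegree F m)]
    exact Finset.sum_eq_zero hsum0
  exact (mul_eq_zero.1 hq).resolve_left (pow_ne_zero _ (Nat.cast_ne_zero.2 Fintype.card_ne_zero))

theorem le_one_of_pow_le {t C : ℝ} {s₀ : ℕ} (h : ∀ s, s₀ ≤ s → t ^ s ≤ C) : t ≤ 1 := by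
  by_contra! ht
  obtain ⟨n, hn⟩ := pow_unbounded_of_one_lt C ht
  have h1 := h (max s₀ n) (le_max_left _ _)
  have h2 := pow_le_pow_right₀ ht.le (le_max_right s₀ n)
  linarith

theorem norm_le_one_of_norm_pow_add_pow_le {x y : ℂ} {C : ℝ} {s₀ : ℕ}
    (h : ∀ s, s₀ ≤ s → ‖x ^ s + y ^ s‖ ≤ C) : ‖x‖ ≤ 1 := by
  have hxy : ‖x * y‖ ≤ 1 := by
    refine le_one_of_pow_le (s₀ := s₀) (C := (C * C + C) / 2) fun s hs => ?_
    have h1 := h s hs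
    have h2 := h (2 * s) (by omega)
    have h3 : (2 : ℂ) * (x * y) ^ s
        = (x ^ s + y ^ s) * (x ^ s + y ^ s) - (x ^ (2 * s) + y ^ (2 * s)) := by ring
    have h4 : 2 * ‖x * y‖ ^ s ≤ ‖x ^ s + y ^ s‖ * ‖x ^ s + y ^ s‖ +
        ‖x ^ (2 * s) + y ^ (2 * s)‖ := by
      rw [← norm_mul, ← norm_pow, ← Complex.norm_two, ← norm_mul, h3]
      exact norm_sub_le _ _
    have h5 := mul_self_le_mul_self (norm_nonneg _) h1
    linarith
  by_contra! hx
  have hy : ‖y‖ ≤ 1 := by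
    rw [norm_mul] at hxy
    nlinarith [norm_nonneg y]
  refine hx.not_ge (le_one_of_pow_le (s₀ := s₀) (C := C + 1) fun s hs => ?_)
  have h1 : ‖x‖ ^ s ≤ ‖x ^ s + y ^ s‖ + ‖y‖ ^ s := by
    rw [← norm_pow, ← norm_pow]
    have := norm_sub_le (x ^ s + y ^ s) (y ^ s)
    rwa [add_sub_cancel_right] at this
  linarith [h s hs, pow_le_one₀ (norm_nonneg y) hy (n := s)]

theorem norm_le_sqrt_of_norm_pow_add_pow_le {α β : ℂ} {q C : ℝ} (hq : 0 < q) {s₀ : ℕ}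
    (h : ∀ s, s₀ ≤ s → ‖α ^ (2 * s) + β ^ (2 * s)‖ ≤ C * q ^ s) : ‖α‖ ≤ √q := by
  have hx : ‖α ^ 2 / q‖ ≤ 1 := by
    refine norm_le_one_of_norm_pow_add_pow_le (y := β ^ 2 / q) (s₀ := s₀) (C := C) fun s hs => ?_
    rw [div_pow, div_pow, ← add_div, ← pow_mul, ← pow_mul, norm_div, norm_pow, Complex.norm_real,
      Real.norm_of_nonneg hq.le, div_le_iff₀ (by positivity)]
    exact h s hs
  rw [norm_div, norm_pow, Complex.norm_real, Real.norm_of_nonneg hq.le, div_le_one hq] at hx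
  exact Real.le_sqrt_of_sq_le hx

/-- Weil's bound for the sum of `χ(x) η(a x² + b x + c)` when `c ≠ 0`. -/
theorem norm_sum_mulChar_quadratic_le_of_ne_zero {F : Type*} [Field F] [Fintype F] {a b c : F}
    (ha : a ≠ 0) (hc : c ≠ 0) (hdisc : b ^ 2 - 4 * a * c ≠ 0) (χ : MulChar F ℂ) {η : MulChar F ℂ}
    (hη : η ≠ 1) :
    ‖∑ x : F, χ x * η (a * x ^ 2 + b * x + c)‖ ≤ 2 * √(Fintype.card F) := by
  set f : F[X] := C a * X ^ 2 + C b * X + C c with hf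
  obtain ⟨e, he⟩ : ∃ e, Fintype.card F = e + 1 :=
    Nat.exists_eq_succ_of_ne_zero Fintype.card_ne_zero
  have hq : 1 < Fintype.card F := Fintype.one_lt_card
  obtain ⟨α, β, hαβ⟩ := exists_primePowerSum_eq (resultantChar_one χ η f)
    (resultantChar_mul χ η f) fun m hm => monicSum_resultantChar_eq_zero ha hc hdisc χ hη hm
  obtain ⟨r, hr⟩ := IsAlgClosed.exists_aeval_eq_zero (AlgebraicClosure F) f (by
    rw [hf, degree_quadratic ha]; norm_num)
  have hr' : aeval r (derivative f) ≠ 0 := by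
    intro h
    apply hdisc
    apply (algebraMap F (AlgebraicClosure F)).injective
    simp only [hf, map_add, map_mul, map_pow, aeval_C, aeval_X] at hr
    simp only [hf, derivative_mul, derivative_C, derivative_X_pow, derivative_X,
      map_add, map_mul, map_pow, aeval_C, aeval_X, map_zero] at h
    simp only [map_sub, map_mul, map_pow, map_zero, map_ofNat]
    norm_num [map_ofNat] at h
    linear_combination (-4 * algebraMap F (AlgebraicClosure F) a) * hr
      + (2 * algebraMap F (AlgebraicClosure F) a * r + algebraMap F (AlgebraicClosure F) b) * h
  have hbound : ∀ s, 30 * e ^ 4 + 1 ≤ s → ‖α ^ (2 * s) + β ^ (2 * s)‖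
      ≤ (e * (4 * e + 3) + 3) * (Fintype.card F : ℝ) ^ s := by
    intro s hs
    obtain ⟨p, hp⟩ := CharP.exists F
    have : Fact p.Prime := ⟨CharP.char_is_prime F p⟩
    have : NeZero (2 * s) := ⟨by omega⟩
    let K := FiniteField.Extension F p (2 * s)
    have : Finite K := Module.finite_of_finite F
    have := Fintype.ofFinite K
    have hR : 30 * e ^ 4 ≤ Fintype.card F ^ s := by
      have : s < Fintype.card F ^ s := Nat.lt_pow_self hq
      omega
    have hK : Fintype.card K = Fintype.card F ^ s * Fintype.card F ^ s := by
      rw [← pow_add, ← two_mul, ← Nat.card_eq_fintype_card, ← Nat.card_eq_fintype_card]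
      exact FiniteField.natCard_extension F p (2 * s)
    have h := norm_normCharSum_le (K := K) (s := s) he (f := f) (natDegree_quadratic ha).le
      (by simpa [hf] using hc) hr hr' (χ := χ) hη rfl hK hR
    rw [normCharSum_eq_primePowerSum, FiniteField.finrank_extension F p (2 * s),
      hαβ _ (by omega), norm_neg] at h
    refine h.trans ?_
    have h1 : (1 : ℝ) ≤ (Fintype.card F : ℝ) ^ s := one_le_pow₀ (by exact_mod_cast hq.le)
    push_cast
    linarith
  have hq0 : (0 : ℝ) < Fintype.card F := by positivity
  have hα := norm_le_sqrt_of_norm_pow_add_pow_le hq0 hbound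
  have hβ := norm_le_sqrt_of_norm_pow_add_pow_le (α := β) (β := α) hq0 fun s hs => by
    rw [add_comm]; exact hbound s hs
  have hS : ∑ x : F, χ x * η (a * x ^ 2 + b * x + c) = -(α ^ 1 + β ^ 1) := by
    rw [← hαβ 1 one_ne_zero, ← Module.finrank_self F, ← normCharSum_eq_primePowerSum, normCharSum]
    simp [Algebra.norm_self, hf]
  rw [hS, norm_neg, pow_one, pow_one]
  linarith [norm_add_le α β]

theorem norm_jacobiSum_le {F : Type*} [Field F] [Fintype F] (χ : MulChar F ℂ) {η : MulChar F ℂ}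
    (hη : η ≠ 1) : ‖jacobiSum χ η‖ ≤ √(Fintype.card F) := by
  have h1 : 1 ≤ √(Fintype.card F : ℝ) :=
    Real.one_le_sqrt.2 (by exact_mod_cast Fintype.card_pos)
  by_cases hχ : χ = 1
  · rw [hχ, jacobiSum_one_nontrivial hη, norm_neg, norm_one]
    exact h1
  by_cases hχη : χ * η = 1
  · rw [eq_inv_of_mul_eq_one_right hχη, jacobiSum_nontrivial_inv hχ, norm_neg]
    exact (χ.norm_apply_le_one _).trans h1
  have hchar : ringChar ℂ ≠ ringChar F := by
    rw [ringChar.eq_zero]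
    exact (CharP.ringChar_ne_zero_of_finite F).symm
  have h := jacobiSum_mul_jacobiSum_inv hchar hχ hη hχη
  have hconj : jacobiSum χ⁻¹ η⁻¹ = (starRingEnd ℂ) (jacobiSum χ η) := by
    simp only [jacobiSum, map_sum, map_mul, ← MulChar.star_apply', Complex.star_def]
  rw [hconj, Complex.mul_conj, Complex.normSq_eq_norm_sq] at h
  refine Real.le_sqrt_of_sq_le (le_of_eq ?_)
  exact_mod_cast h

/-- Weil's bound for the sum of `χ(x) η(a x² + b x + c)`. -/
theorem norm_sum_mulChar_quadratic_le {F : Type*} [Field F] [Fintype F] {a b c : F}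
    (ha : a ≠ 0) (hdisc : b ^ 2 - 4 * a * c ≠ 0) (χ : MulChar F ℂ) {η : MulChar F ℂ}
    (hη : η ≠ 1) :
    ‖∑ x : F, χ x * η (a * x ^ 2 + b * x + c)‖ ≤ 2 * √(Fintype.card F) := by
  rcases eq_or_ne c 0 with rfl | hc
  · have hb : b ≠ 0 := by rintro rfl; simp at hdisc
    have hu : -(b / a) ≠ 0 := neg_ne_zero.2 (div_ne_zero hb ha)
    have hS : ∑ x : F, χ x * η (a * x ^ 2 + b * x + 0)
        = (χ * η) (-(b / a)) * η b * jacobiSum (χ * η) η := by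
      rw [← Equiv.sum_comp (Equiv.mulLeft₀ _ hu), jacobiSum, Finset.mul_sum]
      refine Finset.sum_congr rfl fun x _ => ?_
      have hx : a * (-(b / a) * x) ^ 2 + b * (-(b / a) * x) + 0
          = (-(b / a) * x) * (b * (1 - x)) := by
        field_simp
        ring
      simp only [Equiv.mulLeft₀_apply, hx, map_mul, MulChar.mul_apply]
      ring
    rw [hS, norm_mul, norm_mul]
    have h1 := norm_jacobiSum_le (χ * η) hη
    have h2 : ‖(χ * η) (-(b / a))‖ * ‖η b‖ ≤ 1 :=
      mul_le_one₀ ((χ * η).norm_apply_le_one _) (norm_nonneg _) (η.norm_apply_le_one _)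
    nlinarith [norm_nonneg (jacobiSum (χ * η) η), Real.sqrt_nonneg (Fintype.card F : ℝ)]
  · exact norm_sum_mulChar_quadratic_le_of_ne_zero ha hc hdisc χ hη

theorem sum_range_pow_eq_ite {K : Type*} [Field K] {z : K} {p : ℕ} (hz : z ^ p = 1) :
    ∑ i ∈ Finset.range p, z ^ i = if z = 1 then (p : K) else 0 := by
  split_ifs with h
  · simp [h]
  · exact (mul_eq_zero.mp ((geom_sum_mul z p).trans (by rw [hz, sub_self]))).resolve_right
      (sub_ne_zero.mpr h)

/-- Sums against the indicator function of the `x` at which no character from a finite family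
takes the value `1`. -/
theorem norm_sum_mul_mulChar_of_forall_ne_one_le {F : Type*} [Field F] [Fintype F] (w : F → ℂ)
    {M : ℝ} (hM : ∀ χ : MulChar F ℂ, ‖∑ x, χ x * w x‖ ≤ M) (ξ : ℕ → MulChar F ℂ) (s : Finset ℕ)
    (hs : ∀ p ∈ s, 0 < p ∧ ξ p ^ p = 1) (χ : MulChar F ℂ) :
    ‖∑ x, (if ∀ p ∈ s, ξ p x ≠ 1 then 1 else 0) * (χ x * w x)‖
      ≤ (∏ p ∈ s, 2 * (1 - (p : ℝ)⁻¹)) * M := by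
  induction s using Finset.induction_on generalizing χ with
  | empty => simpa using hM χ
  | insert p s hps ih =>
    obtain ⟨hp, hξ⟩ := hs p (Finset.mem_insert_self _ _)
    have ih := ih fun r hr ↦ hs r (Finset.mem_insert_of_mem hr)
    set B := (∏ p ∈ s, 2 * (1 - (p : ℝ)⁻¹)) * M with hB
    have hp0 : (p : ℂ) ≠ 0 := by exact_mod_cast hp.ne'
    have hp1 : (p : ℝ)⁻¹ ≤ 1 := inv_le_one_of_one_le₀ (by exact_mod_cast hp)
    have key : ∀ x, (if ∀ r ∈ insert p s, ξ r x ≠ 1 then (1 : ℂ) else 0) * (χ x * w x) =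
        (1 - (p : ℂ)⁻¹) * ((if ∀ r ∈ s, ξ r x ≠ 1 then 1 else 0) * (χ x * w x)) -
        (p : ℂ)⁻¹ * ∑ i ∈ Finset.Ico 1 p,
          (if ∀ r ∈ s, ξ r x ≠ 1 then 1 else 0) * ((χ * ξ p ^ i) x * w x) := by
      intro x
      rcases eq_or_ne x 0 with rfl | hx
      · simp [MulChar.map_zero]
      have hz : ξ p x ^ p = 1 := by
        rw [← MulChar.pow_apply' _ hp.ne', hξ, MulChar.one_apply (isUnit_iff_ne_zero.mpr hx)]
      have hsum := sum_range_pow_eq_ite hz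
      rw [Finset.range_eq_Ico, Finset.sum_eq_sum_Ico_succ_bot hp] at hsum
      have hrw : ∑ i ∈ Finset.Ico 1 p,
          (if ∀ r ∈ s, ξ r x ≠ 1 then (1 : ℂ) else 0) * ((χ * ξ p ^ i) x * w x) =
          (if ∀ r ∈ s, ξ r x ≠ 1 then 1 else 0) * (χ x * w x) *
            ((if ξ p x = 1 then (p : ℂ) else 0) - 1) := by
        rw [← hsum, pow_zero, zero_add, add_sub_cancel_left, Finset.mul_sum]
        refine Finset.sum_congr rfl fun i hi ↦ ?_
        rw [MulChar.mul_apply, MulChar.pow_apply' _ (by have := Finset.mem_Ico.mp hi; omega)]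
        ring
      rw [hrw]
      by_cases h1 : ξ p x = 1
      · simp only [Finset.forall_mem_insert, h1, ne_eq, not_true_eq_false, false_and, if_false,
          if_true]
        field_simp
        ring
      · simp only [Finset.forall_mem_insert, h1, ne_eq, not_false_eq_true, true_and, if_false]
        ring
    calc _ = ‖(1 - (p : ℂ)⁻¹) * ∑ x, (if ∀ r ∈ s, ξ r x ≠ 1 then 1 else 0) * (χ x * w x) -
        (p : ℂ)⁻¹ * ∑ i ∈ Finset.Ico 1 p, ∑ x,
          (if ∀ r ∈ s, ξ r x ≠ 1 then 1 else 0) * ((χ * ξ p ^ i) x * w x)‖ := by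
          rw [Finset.sum_congr rfl fun x _ ↦ key x, Finset.sum_sub_distrib, Finset.mul_sum,
            Finset.sum_comm, Finset.mul_sum]
      _ ≤ (1 - (p : ℝ)⁻¹) * B + (p : ℝ)⁻¹ * ((p - 1) * B) := by
          refine (norm_sub_le _ _).trans (add_le_add ?_ ?_)
          · rw [norm_mul, show (1 - (p : ℂ)⁻¹) = ((1 - (p : ℝ)⁻¹ : ℝ) : ℂ) by push_cast; rfl,
              Complex.norm_real, Real.norm_of_nonneg (sub_nonneg.mpr hp1)]
            exact mul_le_mul_of_nonneg_left (ih χ) (sub_nonneg.mpr hp1)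
          · rw [norm_mul, norm_inv, Complex.norm_natCast]
            refine mul_le_mul_of_nonneg_left ?_ (by positivity)
            refine (norm_sum_le_of_le _ fun i _ ↦ ih (χ * ξ p ^ i)).trans (le_of_eq ?_)
            rw [Finset.sum_const, Nat.card_Ico, nsmul_eq_mul, Nat.cast_sub hp, Nat.cast_one]
      _ = _ := by
          rw [Finset.prod_insert hps, mul_assoc _ _ M, ← hB]
          have : (p : ℝ) ≠ 0 := by exact_mod_cast hp.ne'
          field_simp
          ring

theorem exists_generator_units_pow (F : Type*) [Field F] [Finite F] :
    ∃ g : Fˣ, ∀ x : F, x ≠ 0 → ∃ j : ℕ, x = (g : F) ^ j := by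
  obtain ⟨g, hg⟩ := IsCyclic.exists_monoid_generator (α := Fˣ)
  refine ⟨g, fun x hx ↦ ?_⟩
  obtain ⟨j, hj⟩ := hg (Units.mk0 x hx)
  exact ⟨j, by simpa using (congrArg Units.val hj).symm⟩

theorem MulChar.apply_eq_one_iff_exists_pow {F : Type*} [Field F] [Finite F] (χ : MulChar F ℂ)
    {x : F} (hx : x ≠ 0) : χ x = 1 ↔ ∃ y, y ≠ 0 ∧ y ^ orderOf χ = x := by
  constructor
  · intro h
    obtain ⟨g, hg⟩ := exists_generator_units_pow F
    obtain ⟨j, rfl⟩ := hg x hx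
    have hχ : χ ^ j = 1 := by
      ext u
      obtain ⟨i, hi⟩ := hg u u.ne_zero
      rw [MulChar.pow_apply_coe, MulChar.one_apply_coe, hi, ← map_pow, ← pow_mul, mul_comm,
        pow_mul, map_pow, h, one_pow]
    obtain ⟨m, rfl⟩ := orderOf_dvd_of_pow_eq_one hχ
    exact ⟨(g : F) ^ m, pow_ne_zero _ g.ne_zero, by rw [← pow_mul, mul_comm]⟩
  · rintro ⟨y, hy, rfl⟩
    rw [map_pow, ← MulChar.pow_apply' _ χ.orderOf_pos.ne', pow_orderOf_eq_one,
      MulChar.one_apply (isUnit_iff_ne_zero.mpr hy)]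

theorem isPrimitiveElement_coe_iff {F : Type*} [Field F] [Fintype F] (u : Fˣ) :
    IsPrimitiveElement (u : F) ↔ orderOf u = Fintype.card F - 1 := by
  rw [← Fintype.card_units, ← Nat.card_eq_fintype_card]
  constructor
  · refine fun h ↦ orderOf_eq_card_of_forall_mem_powers fun v ↦ ?_
    obtain ⟨n, hn⟩ := h v v.ne_zero
    exact ⟨n, Units.ext (by simpa using hn)⟩
  · intro h y hy
    have hmem : Units.mk0 y hy ∈ Submonoid.powers u := by
      rw [mem_powers_iff_mem_zpowers, Subgroup.eq_top_of_card_eq (Subgroup.zpowers u)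
        ((Nat.card_zpowers u).trans h)]
      trivial
    obtain ⟨n, hn⟩ := hmem
    exact ⟨n, by simpa using congrArg Units.val hn⟩

theorem IsPrimitiveElement.ne_zero {F : Type*} [Field F] [Fintype F] {x : F}
    (hF : 2 < Fintype.card F) (hx : IsPrimitiveElement x) : x ≠ 0 := by
  rintro rfl
  have hsub : (Finset.univ : Finset F) ⊆ {0, 1} := fun y _ ↦ by
    by_cases hy : y = 0
    · simp [hy]
    · obtain ⟨n, hn⟩ := hx y hy
      rcases n with - | n
      · simp [← hn]
      · simp [← hn]
  have := (Finset.card_le_card hsub).trans Finset.card_le_two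
  rw [Finset.card_univ] at this
  omega

theorem isPrimitiveElement_iff_forall_mulChar_ne_one {F : Type*} [Field F] [Fintype F]
    {ξ : ℕ → MulChar F ℂ} (hξ : ∀ p ∈ (Fintype.card F - 1).primeFactors, orderOf (ξ p) = p)
    {x : F} (hx : x ≠ 0) :
    IsPrimitiveElement x ↔ ∀ p ∈ (Fintype.card F - 1).primeFactors, ξ p x ≠ 1 := by
  constructor
  · intro h p hp h1
    have hχ : ξ p = 1 := by
      ext u
      obtain ⟨n, hn⟩ := h u u.ne_zero
      rw [MulChar.one_apply_coe, ← hn, map_pow, h1, one_pow]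
    have := hξ p hp
    rw [hχ, orderOf_one] at this
    exact (Nat.prime_of_mem_primeFactors hp).one_lt.ne this
  · intro h
    lift x to Fˣ using isUnit_iff_ne_zero.mpr hx with u
    have hn : 0 < Fintype.card F - 1 := Nat.sub_pos_of_lt Fintype.one_lt_card
    rw [isPrimitiveElement_coe_iff]
    refine orderOf_eq_of_pow_and_pow_div_prime hn ?_ fun p hp hpn hu ↦ ?_
    · rw [← Fintype.card_units, pow_card_eq_one]
    · have hpm := Nat.mem_primeFactors.mpr ⟨hp, hpn, hn.ne'⟩
      refine h p hpm ?_
      rw [MulChar.apply_eq_one_iff_exists_pow _ hx, hξ p hpm]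
      obtain ⟨g, hg⟩ := IsCyclic.exists_ofOrder_eq_natCard (α := Fˣ)
      have hmem : u ∈ Submonoid.powers g := by
        rw [mem_powers_iff_mem_zpowers, Subgroup.eq_top_of_card_eq (Subgroup.zpowers g)
          ((Nat.card_zpowers g).trans hg)]
        trivial
      obtain ⟨j, rfl⟩ := hmem
      rw [Nat.card_eq_fintype_card, Fintype.card_units] at hg
      simp only [← pow_mul] at hu
      have h2 := orderOf_dvd_of_pow_eq_one hu
      rw [hg] at h2
      obtain ⟨m, hm⟩ := hpn
      have hm0 : 0 < m := by
        rcases Nat.eq_zero_or_pos m with rfl | h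
        · omega
        · exact h
      rw [hm, Nat.mul_div_cancel_left _ hp.pos] at h2
      obtain ⟨i, rfl⟩ := Nat.dvd_of_mul_dvd_mul_right hm0 h2
      exact ⟨(g : F) ^ i, pow_ne_zero _ g.ne_zero, by push_cast; rw [← pow_mul, mul_comm]⟩

theorem card_isPrimitiveElement {F : Type*} [Field F] [Fintype F] (hF : 2 < Fintype.card F) :
    (Finset.univ.filter fun x : F ↦ IsPrimitiveElement x).card =
      Nat.totient (Fintype.card F - 1) := by
  rw [← IsCyclic.card_orderOf_eq_totient (α := Fˣ) (d := Fintype.card F - 1)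
    (by rw [Fintype.card_units])]
  symm
  refine Finset.card_bij (fun u _ ↦ (u : F)) ?_ (fun _ _ _ _ h ↦ Units.ext h) ?_
  · intro u hu
    simpa [isPrimitiveElement_coe_iff] using hu
  · intro x hx
    have hx := (Finset.mem_filter.mp hx).2
    refine ⟨Units.mk0 x (hx.ne_zero hF), ?_, rfl⟩
    simpa [← isPrimitiveElement_coe_iff] using hx

theorem MulChar.sum_range_pow_apply {F : Type*} [Field F] [Finite F] (η : MulChar F ℂ) (y : F) :
    ∑ i ∈ Finset.range (orderOf η), (η ^ i) y =
      if ∃ z, z ≠ 0 ∧ z ^ orderOf η = y then (orderOf η : ℂ) else 0 := by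
  rcases eq_or_ne y 0 with rfl | hy
  · rw [if_neg, Finset.sum_eq_zero fun i _ ↦ MulChar.map_zero _]
    rintro ⟨z, hz, h⟩
    exact pow_ne_zero _ hz h
  · have h1 : ∀ i, (η ^ i) y = η y ^ i := fun i ↦ MulChar.pow_apply_coe η i (Units.mk0 y hy)
    have h2 : η y ^ orderOf η = 1 := by
      rw [← h1, pow_orderOf_eq_one, MulChar.one_apply (isUnit_iff_ne_zero.mpr hy)]
    simp_rw [h1, sum_range_pow_eq_ite h2, MulChar.apply_eq_one_iff_exists_pow η hy]

theorem card_filter_quadratic_eq_zero_le {F : Type*} [Field F] [Fintype F] {a : F} (b c : F)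
    (ha : a ≠ 0) : (Finset.univ.filter fun x : F ↦ a * x ^ 2 + b * x + c = 0).card ≤ 2 := by
  have hdeg : (C a * X ^ 2 + C b * X + C c : F[X]).natDegree = 2 := natDegree_quadratic ha
  have h0 : (C a * X ^ 2 + C b * X + C c : F[X]) ≠ 0 := by
    intro h
    simp [h] at hdeg
  refine (Polynomial.card_le_degree_of_subset_roots fun x hx ↦ ?_).trans hdeg.le
  rw [mem_roots h0]
  simpa using hx

theorem Wnum_eq_two_pow_card_primeFactors {n : ℕ} (hn : n ≠ 0) :
    Wnum n = 2 ^ n.primeFactors.card := by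
  rw [Wnum, Finset.card_eq_sum_ones, Nat.sum_divisors_filter_squarefree hn, Finset.sum_const,
    Finset.card_powerset, Nat.factors_eq, smul_eq_mul, mul_one]
  rfl

theorem prod_primeFactors_eq_Wnum_mul_totient_div {n : ℕ} (hn : n ≠ 0) :
    ∏ p ∈ n.primeFactors, 2 * (1 - (p : ℝ)⁻¹) = Wnum n * (Nat.totient n : ℝ) / n := by
  have h : (Nat.totient n : ℝ) = n * ∏ p ∈ n.primeFactors, (1 - (p : ℝ)⁻¹) := by
    have := congrArg (Rat.cast : ℚ → ℝ) (Nat.totient_eq_mul_prod_factors n)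
    push_cast at this
    exact this
  have hn' : (n : ℝ) ≠ 0 := by exact_mod_cast hn
  rw [Finset.prod_mul_distrib, Finset.prod_const, Wnum_eq_two_pow_card_primeFactors hn, h]
  push_cast
  field_simp

theorem one_le_prod_primeFactors (n : ℕ) :
    1 ≤ ∏ p ∈ n.primeFactors, 2 * (1 - (p : ℝ)⁻¹) := by
  refine Finset.prod_const_one.symm.trans_le (Finset.prod_le_prod
    (s := n.primeFactors) (fun _ _ ↦ zero_le_one) fun p hp ↦ ?_)
  have h2 : (2 : ℝ) ≤ p := by exact_mod_cast (Nat.prime_of_mem_primeFactors hp).two_le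
  have : (p : ℝ)⁻¹ ≤ 2⁻¹ := inv_anti₀ (by norm_num) h2
  linarith

/-- Counting primitive elements whose image under a quadratic is a nonzero `k`-th power. -/
theorem totient_sub_le_mul_card_filter_isPrimitiveElement {F : Type*} [Field F] [Fintype F]
    {k : ℕ} (hF : 2 < Fintype.card F) (hkdvd : k ∣ Fintype.card F - 1) {a b c : F} (ha : a ≠ 0)
    (hdisc : b ^ 2 - 4 * a * c ≠ 0) :
    (Nat.totient (Fintype.card F - 1) : ℝ) - 2 - (k - 1) *
      ((∏ p ∈ (Fintype.card F - 1).primeFactors, 2 * (1 - (p : ℝ)⁻¹)) * (2 * √(Fintype.card F)))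
      ≤ k * (Finset.univ.filter fun x : F ↦ IsPrimitiveElement x ∧
          ∃ y : F, y ≠ 0 ∧ y ^ k = a * x ^ 2 + b * x + c).card := by
  set n := Fintype.card F - 1 with hn
  have hn0 : 0 < n := by omega
  have hk : 0 < k := Nat.pos_of_dvd_of_pos hkdvd hn0
  have hex : ∀ d, d ∣ n → ∃ χ : MulChar F ℂ, orderOf χ = d := fun d hd ↦
    MulChar.exists_mulChar_orderOf F hd
      (Complex.isPrimitiveRoot_exp d (Nat.pos_of_dvd_of_pos hd hn0).ne')
  choose! ξ hξ using hex
  have hξp : ∀ p ∈ n.primeFactors, orderOf (ξ p) = p := fun p hp ↦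
    hξ p (Nat.dvd_of_mem_primeFactors hp)
  set B := ∏ p ∈ n.primeFactors, 2 * (1 - (p : ℝ)⁻¹)
  set f : F → F := fun x ↦ a * x ^ 2 + b * x + c with hf
  set P : F → ℂ := fun x ↦ if IsPrimitiveElement x then 1 else 0 with hP
  have hPeq : ∀ x, P x =
      (if ∀ p ∈ n.primeFactors, ξ p x ≠ 1 then 1 else 0) * (1 : MulChar F ℂ) x := by
    intro x
    rcases eq_or_ne x 0 with rfl | hx
    · simp [hP, show ¬ IsPrimitiveElement (0 : F) from fun h ↦ h.ne_zero hF rfl, MulChar.map_zero]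
    · simp only [hP, isPrimitiveElement_iff_forall_mulChar_ne_one hξp hx,
        MulChar.one_apply (isUnit_iff_ne_zero.mpr hx), mul_one]
      rfl
  have hbound : ∀ i ∈ Finset.Ico 1 k, ‖∑ x, P x * (ξ k ^ i) (f x)‖ ≤
      B * (2 * √(Fintype.card F)) := by
    intro i hi
    rw [Finset.mem_Ico] at hi
    have hη : ξ k ^ i ≠ 1 := pow_ne_one_of_lt_orderOf (by omega) (by rw [hξ k hkdvd]; exact hi.2)
    have := norm_sum_mul_mulChar_of_forall_ne_one_le (fun x ↦ (ξ k ^ i) (f x))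
      (fun χ ↦ norm_sum_mulChar_quadratic_le ha hdisc χ hη) ξ n.primeFactors
      (fun p hp ↦ ⟨(Nat.prime_of_mem_primeFactors hp).pos, by
        conv_lhs => rw [← hξp p hp, hξp p hp]
        simpa [hξp p hp] using pow_orderOf_eq_one (ξ p)⟩) 1
    simpa only [hPeq, mul_assoc] using this
  set S := Finset.univ.filter fun x : F ↦ IsPrimitiveElement x ∧ ∃ y : F, y ≠ 0 ∧ y ^ k = f x
  set T := Finset.univ.filter fun x : F ↦ IsPrimitiveElement x ∧ f x ≠ 0
  have hcount : (k : ℂ) * S.card = T.card + ∑ i ∈ Finset.Ico 1 k, ∑ x, P x * (ξ k ^ i) (f x) := by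
    have h1 : (k : ℂ) * S.card = ∑ x, P x * ∑ i ∈ Finset.range k, (ξ k ^ i) (f x) := by
      have h2 : ∀ x, ∑ i ∈ Finset.range k, (ξ k ^ i) (f x) =
          if ∃ y : F, y ≠ 0 ∧ y ^ k = f x then (k : ℂ) else 0 := fun x ↦ by
        simpa only [hξ k hkdvd] using MulChar.sum_range_pow_apply (ξ k) (f x)
      simp_rw [h2, hP, ite_mul, one_mul, zero_mul, ← ite_and]
      rw [← Finset.sum_filter, Finset.sum_const, nsmul_eq_mul, mul_comm]
    have h3 : (T.card : ℂ) = ∑ x, P x * (ξ k ^ 0) (f x) := by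
      have h4 : ∀ x, (ξ k ^ 0) (f x) = if f x ≠ 0 then (1 : ℂ) else 0 := fun x ↦ by
        by_cases h : f x = 0
        · simp [h, MulChar.map_zero]
        · rw [pow_zero, MulChar.one_apply (isUnit_iff_ne_zero.mpr h), if_pos h]
      simp_rw [h4, hP, ite_mul, one_mul, zero_mul, ← ite_and]
      rw [← Finset.sum_filter, Finset.sum_const, nsmul_eq_mul, mul_one]
    rw [h1, h3]
    simp_rw [Finset.mul_sum]
    rw [Finset.sum_comm, Finset.range_eq_Ico, Finset.sum_eq_sum_Ico_succ_bot hk, zero_add]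
  have hT : (Nat.totient n : ℝ) - 2 ≤ T.card := by
    have h1 : (Finset.univ.filter fun x : F ↦ IsPrimitiveElement x).card ≤
        T.card + (Finset.univ.filter fun x : F ↦ f x = 0).card := by
      refine le_trans (Finset.card_le_card fun x hx ↦ ?_) (Finset.card_union_le _ _)
      have hx := (Finset.mem_filter.mp hx).2
      by_cases h : f x = 0
      · simp [h]
      · simp [T, h, hx]
    rw [card_isPrimitiveElement hF] at h1
    have h2 := card_filter_quadratic_eq_zero_le b c ha
    have h3 : Nat.totient n ≤ T.card + 2 := h1.trans (Nat.add_le_add_left h2 _)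
    have : (Nat.totient n : ℝ) ≤ T.card + 2 := by exact_mod_cast h3
    linarith
  have hE : ‖(k : ℂ) * S.card - T.card‖ ≤ (k - 1) * (B * (2 * √(Fintype.card F))) := by
    rw [hcount, add_sub_cancel_left]
    refine (norm_sum_le_of_le _ hbound).trans (le_of_eq ?_)
    rw [Finset.sum_const, Nat.card_Ico, nsmul_eq_mul, Nat.cast_sub hk, Nat.cast_one]
  rw [show (k : ℂ) * S.card - T.card = (((k : ℝ) * S.card - T.card : ℝ) : ℂ) by push_cast; rfl,
    Complex.norm_real] at hE
  have := (abs_le.mp hE).1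
  linarith

end CharacterSums

theorem primitive_count_lower_bound
    {F : Type*} [Field F] [Fintype F] {q k : ℕ} (hq : Fintype.card F = q) (hq5 : 5 ≤ q)
    (hk : 2 ≤ k) (hkdvd : k ∣ q - 1)
    (a b c : F) (ha : a ≠ 0) (hdisc : b ^ 2 - 4 * a * c ≠ 0)
    {N : ℕ} (hN : N = Nat.card {x : F | IsPrimitiveElement x ∧
      ∃ y : F, y ≠ 0 ∧ y ^ k = a * x ^ 2 + b * x + c}) :
    (q : ℝ) - 2 * (k : ℝ) * (Wnum (q - 1) : ℝ) * Real.sqrt q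
      ≤ ((k : ℝ) * ((q : ℝ) - 1)) / (Nat.totient (q - 1) : ℝ) * (N : ℝ) := by
  subst hq
  have main := totient_sub_le_mul_card_filter_isPrimitiveElement (by omega) hkdvd ha hdisc
  have hn : Fintype.card F - 1 ≠ 0 := by omega
  have hB := prod_primeFactors_eq_Wnum_mul_totient_div hn
  have hB1 := one_le_prod_primeFactors (Fintype.card F - 1)
  have hN' : N = (Finset.univ.filter fun x : F ↦ IsPrimitiveElement x ∧
      ∃ y : F, y ≠ 0 ∧ y ^ k = a * x ^ 2 + b * x + c).card := by
    rw [hN, Nat.card_eq_fintype_card, ← Set.toFinset_card, Set.toFinset_ofPred]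
  rw [← hN'] at main
  have hcast : ((Fintype.card F - 1 : ℕ) : ℝ) = Fintype.card F - 1 := by
    rw [Nat.cast_sub (by omega), Nat.cast_one]
  have hφ : (0 : ℝ) < Nat.totient (Fintype.card F - 1) := by
    exact_mod_cast Nat.totient_pos.mpr (Nat.pos_of_ne_zero hn)
  have hq4 : (4 : ℝ) ≤ Fintype.card F - 1 := by
    have : (5 : ℝ) ≤ Fintype.card F := by exact_mod_cast hq5
    linarith
  have hsqrt : 2 ≤ √(Fintype.card F : ℝ) := Real.le_sqrt_of_sq_le (by linarith)
  rw [hcast] at hB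
  rw [hB] at main hB1
  have hW1 : (1 : ℝ) ≤ Wnum (Fintype.card F - 1) := by
    rw [Wnum_eq_two_pow_card_primeFactors hn]
    exact_mod_cast Nat.one_le_two_pow
  generalize (Wnum (Fintype.card F - 1) : ℝ) = W at *
  generalize (Nat.totient (Fintype.card F - 1) : ℝ) = φ at *
  generalize √(Fintype.card F : ℝ) = s at *
  generalize (Fintype.card F : ℝ) = r at *
  have hr : 0 < r - 1 := by linarith
  have hφW : (r - 1) / φ ≤ W := by
    rw [le_div_iff₀ hr, one_mul] at hB1
    rwa [div_le_iff₀ hφ]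
  have h1 := mul_le_mul_of_nonneg_left main (div_pos hr hφ).le
  have h2 : (r - 1) / φ * (φ - 2 - (k - 1) * (W * φ / (r - 1) * (2 * s))) =
      (r - 1) - 2 * ((r - 1) / φ) - 2 * (k - 1) * W * s := by
    field_simp
  have h3 : (r - 1) / φ * (k * N) = k * (r - 1) / φ * N := by ring
  rw [h2, h3] at h1
  nlinarith
end

section
/- Let q be a prime power, F_q the finite field with q elements, k a positive divisor of q-1 with k ≥ 2, and f(x) = ax² + bx + c ∈ F_q[x] a quadratic polynomial (a ≠ 0) with b² - 4ac ≠ 0. Fix a multiplicative character χ_k of F_q of order k (with χ_k(0) = 0). Let t be a positive divisor of q-1 and let p be a prime dividing q-1 but not dividing t. Then N(p t, k) - (1 - 1/p) N(t, k) = (φ(p t)/(k p t)) · Σ_{i=0}^{k-1} Σ_{d ∣ t} (μ(p d)/φ(p d)) Σ_{χ of order p d} S_i(χ), where S_i(χ) = Σ_{x ∈ F_q} χ(x) χ_k^i(f(x)), μ is the Möbius function, φ is Euler's totient function, and the inner sum runs over all multiplicative characters of F_q of order exactly p d. -/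
open scoped Classical

noncomputable instance {F : Type*} [Field F] [Fintype F] : Fintype (MulChar F ℂ) :=
  Fintype.ofFinite _

section CharacterSums

variable {F : Type*} [Field F] [Fintype F]

lemma MulChar.sum_range_orderOf_pow_apply (χ : MulChar F ℂ) (x : F) :
    ∑ i ∈ Finset.range (orderOf χ), (χ ^ i) x =
      if ∃ y : F, y ≠ 0 ∧ y ^ orderOf χ = x then (orderOf χ : ℂ) else 0 := by
  rcases eq_or_ne x 0 with rfl | hx
  · rw [if_neg]
    · exact Finset.sum_eq_zero fun i _ => MulChar.map_zero _
    · rintro ⟨y, hy, h⟩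
      exact pow_ne_zero _ hy h
  obtain ⟨u, rfl⟩ : ∃ u : Fˣ, (u : F) = x := ⟨Units.mk0 x hx, rfl⟩
  simp only [MulChar.pow_apply_coe]
  have hpow : χ (u : F) ^ orderOf χ = 1 := by
    rw [← MulChar.pow_apply_coe, pow_orderOf_eq_one, MulChar.one_apply_coe]
  split_ifs with h
  · obtain ⟨y, hy, h⟩ := h
    have h1 : χ (u : F) = 1 := by
      obtain ⟨v, rfl⟩ : ∃ v : Fˣ, (v : F) = y := ⟨Units.mk0 y hy, rfl⟩
      rw [← h, map_pow, ← MulChar.pow_apply_coe, pow_orderOf_eq_one, MulChar.one_apply_coe]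
    simp [h1]
  · have h1 : χ (u : F) ≠ 1 := by
      intro h1
      obtain ⟨g, hg⟩ := IsCyclic.exists_generator (α := Fˣ)
      obtain ⟨m, rfl⟩ := mem_powers_iff_mem_zpowers.mpr (hg u)
      have hm : χ ^ m = 1 := by
        rw [MulChar.eq_iff hg, MulChar.pow_apply_coe, MulChar.one_apply_coe, ← map_pow]
        simpa using h1
      obtain ⟨l, rfl⟩ := orderOf_dvd_of_pow_eq_one hm
      exact h ⟨((g ^ l : Fˣ) : F), Units.ne_zero _, by simp [← pow_mul, mul_comm]⟩
    rw [geom_sum_eq h1, hpow, sub_self, zero_div]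

/-- The sum of the values at `x` of the multiplicative characters of order exactly `n`. -/
noncomputable def charSumOfOrder (n : ℕ) (x : F) : ℂ :=
  ∑ χ ∈ Finset.univ.filter (fun χ : MulChar F ℂ => orderOf χ = n), χ x

lemma charSumOfOrder_zero_right (n : ℕ) : charSumOfOrder n (0 : F) = 0 :=
  Finset.sum_eq_zero fun χ _ => χ.map_zero

lemma charSumOfOrder_one {x : F} (hx : x ≠ 0) : charSumOfOrder 1 x = 1 := by
  have h : Finset.univ.filter (fun χ : MulChar F ℂ => orderOf χ = 1) = {1} := by
    ext χ
    simp
  rw [charSumOfOrder, h, Finset.sum_singleton, MulChar.one_apply hx.isUnit]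

lemma charSumOfOrder_mul {m n : ℕ} (h : m.Coprime n) (x : F) :
    charSumOfOrder (m * n) x = charSumOfOrder m x * charSumOfOrder n x := by
  rw [charSumOfOrder, charSumOfOrder, charSumOfOrder, Finset.sum_mul_sum, ← Finset.sum_product']
  symm
  refine Finset.sum_bij (fun c _ => c.1 * c.2) ?_ ?_ ?_ ?_
  · rintro ⟨χ, ψ⟩ hc
    obtain ⟨rfl, rfl⟩ : orderOf χ = m ∧ orderOf ψ = n := by simpa using hc
    simpa using (Commute.all χ ψ).orderOf_mul_eq_mul_orderOf_of_coprime h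
  · rintro ⟨χ, ψ⟩ hc ⟨χ', ψ'⟩ hc' heq
    obtain ⟨h1, h2⟩ : orderOf χ = m ∧ orderOf ψ = n := by simpa using hc
    obtain ⟨h3, h4⟩ : orderOf χ' = m ∧ orderOf ψ' = n := by simpa using hc'
    have heq' : χ / χ' = ψ' / ψ := by
      rw [div_eq_div_iff_mul_eq_mul, mul_comm ψ' χ']
      exact heq
    have hone : χ / χ' = 1 := by
      rw [← orderOf_eq_one_iff, ← Nat.dvd_one, ← h]
      refine Nat.dvd_gcd (orderOf_dvd_of_pow_eq_one ?_) (orderOf_dvd_of_pow_eq_one ?_)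
      · rw [div_pow, ← h1, pow_orderOf_eq_one, h1, ← h3, pow_orderOf_eq_one, div_one]
      · rw [heq', div_pow, ← h2, pow_orderOf_eq_one, h2, ← h4, pow_orderOf_eq_one, div_one]
    rw [Prod.mk.injEq]
    exact ⟨div_eq_one.mp hone, (div_eq_one.mp (heq' ▸ hone)).symm⟩
  · intro χ hχ
    have hχ : orderOf χ = m * n := by simpa using hχ
    have hpos : 0 < m * n := hχ ▸ MulChar.orderOf_pos χ
    obtain ⟨a, ha⟩ := Nat.chineseRemainder h 1 0
    obtain ⟨b, hb⟩ := Nat.chineseRemainder h 0 1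
    have hord : ∀ {r s e : ℕ}, 0 < r → 0 < s → r.Coprime s → orderOf χ = r * s →
        e ≡ 1 [MOD r] → e ≡ 0 [MOD s] → orderOf (χ ^ e) = r := by
      intro r s e hr hs hrs hχ he1 he0
      have hgcd : (r * s).gcd e = s := by
        have hs' : s ∣ e := (Nat.modEq_zero_iff_dvd).mp he0
        have hr' : r.Coprime e := by
          rw [Nat.Coprime, Nat.gcd_comm, he1.gcd_eq, Nat.gcd_one_left]
        rw [hr'.gcd_mul_left_cancel, Nat.gcd_eq_left hs']
      rw [orderOf_pow, hχ, hgcd, Nat.mul_div_cancel _ hs]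
    have hm := Nat.pos_of_mul_pos_right hpos
    have hn := Nat.pos_of_mul_pos_left hpos
    refine ⟨(χ ^ a, χ ^ b), ?_, ?_⟩
    · simpa using ⟨hord hm hn h hχ ha.1 ha.2,
        hord hn hm h.symm (hχ.trans (mul_comm m n)) hb.2 hb.1⟩
    · have hab : a + b ≡ 1 [MOD orderOf χ] := by
        rw [hχ]
        exact (Nat.modEq_and_modEq_iff_modEq_mul h).mp ⟨ha.1.add hb.1, ha.2.add hb.2⟩
      change χ ^ a * χ ^ b = χ
      rw [← pow_add]
      simpa using pow_eq_pow_iff_modEq.mpr hab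
  · rintro ⟨χ, ψ⟩ -
    exact (MulChar.mul_apply χ ψ x).symm

lemma charSumOfOrder_prime {p : ℕ} (hp : p.Prime) (hpq : p ∣ Fintype.card F - 1) {x : F}
    (hx : x ≠ 0) :
    charSumOfOrder p x = (if ∃ y : F, y ^ p = x then (p : ℂ) else 0) - 1 := by
  obtain ⟨χ, hχ⟩ := MulChar.exists_mulChar_orderOf F hpq
    (Complex.isPrimitiveRoot_exp p hp.ne_zero)
  obtain ⟨g, hg⟩ := IsCyclic.exists_generator (α := Fˣ)
  have hprim : IsPrimitiveRoot (χ g) p := by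
    constructor
    · rw [← MulChar.pow_apply_coe, ← hχ, pow_orderOf_eq_one, MulChar.one_apply_coe]
    · intro l hl
      rw [← hχ]
      apply orderOf_dvd_of_pow_eq_one
      rw [MulChar.eq_iff hg, MulChar.pow_apply_coe, hl, MulChar.one_apply_coe]
  have hsum := MulChar.sum_range_orderOf_pow_apply χ x
  have hex : (∃ y : F, y ≠ 0 ∧ y ^ p = x) ↔ ∃ y : F, y ^ p = x := by
    refine ⟨fun ⟨y, _, h⟩ => ⟨y, h⟩, fun ⟨y, h⟩ => ⟨y, ?_, h⟩⟩
    rintro rfl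
    exact hx (by rw [← h, zero_pow hp.ne_zero])
  rw [hχ] at hsum
  simp only [hex] at hsum
  rw [← hsum, Finset.range_eq_Ico, Finset.sum_eq_sum_Ico_succ_bot hp.pos, pow_zero,
    MulChar.one_apply hx.isUnit, add_sub_cancel_left, zero_add]
  symm
  refine Finset.sum_bij (fun i _ => χ ^ i) ?_ ?_ ?_ (fun _ _ => rfl)
  · intro i hi
    have hi := Finset.mem_Ico.mp hi
    have : p.Coprime i := Nat.coprime_of_lt_prime (by omega) hi.2 hp
    rw [Finset.mem_filter, orderOf_pow, hχ, this, Nat.div_one]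
    exact ⟨Finset.mem_univ _, rfl⟩
  · intro i hi j hj hij
    exact pow_injOn_Iio_orderOf (hχ.symm ▸ (Finset.mem_Ico.mp hi).2)
      (hχ.symm ▸ (Finset.mem_Ico.mp hj).2) hij
  · intro ψ hψ
    have hψ : orderOf ψ = p := by simpa using hψ
    have : NeZero p := ⟨hp.ne_zero⟩
    have hψg : ψ g ^ p = 1 := by
      rw [← MulChar.pow_apply_coe, ← hψ, pow_orderOf_eq_one, MulChar.one_apply_coe]
    obtain ⟨i, hi, h⟩ := hprim.eq_pow_of_pow_eq_one hψg
    have hψi : χ ^ i = ψ := by rw [MulChar.eq_iff hg, MulChar.pow_apply_coe, h]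
    refine ⟨i, Finset.mem_Ico.mpr ⟨Nat.one_le_iff_ne_zero.mpr ?_, hi⟩, hψi⟩
    rintro rfl
    rw [← hψi, pow_zero, orderOf_one] at hψ
    exact hp.one_lt.ne hψ

end CharacterSums

section FreeElements

variable {F : Type*} [Field F]

lemma isTFree_iff_forall_prime {t : ℕ} {x : F} :
    IsTFree t x ↔ x ≠ 0 ∧ ∀ p : ℕ, p.Prime → p ∣ t → ¬∃ y : F, y ^ p = x := by
  refine and_congr_right fun _ => ⟨fun h p hp hpt hy => hp.ne_one (h p hp.pos hpt hy), ?_⟩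
  rintro h d - hdt ⟨y, rfl⟩
  by_contra hd
  exact h d.minFac (Nat.minFac_prime hd) (d.minFac_dvd.trans hdt)
    ⟨y ^ (d / d.minFac), by rw [← pow_mul, Nat.div_mul_cancel d.minFac_dvd]⟩

lemma isTFree_prime_mul {p t : ℕ} (hp : p.Prime) {x : F} :
    IsTFree (p * t) x ↔ IsTFree t x ∧ ¬∃ y : F, y ^ p = x := by
  rw [isTFree_iff_forall_prime, isTFree_iff_forall_prime, and_assoc]
  refine and_congr_right fun _ => ⟨fun h => ⟨fun r hr hrt => h r hr (hrt.mul_left p),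
    h p hp (dvd_mul_right p t)⟩, ?_⟩
  rintro ⟨h, hpx⟩ r hr hrt
  rcases (hr.dvd_mul).mp hrt with hrp | hrt
  · rwa [(Nat.prime_dvd_prime_iff_eq hr hp).mp hrp]
  · exact h r hr hrt

end FreeElements

lemma Nat.Prime.sum_divisors_mul_of_not_dvd {M : Type*} [AddCommMonoid M] {p t : ℕ}
    (hp : p.Prime) (hpt : ¬p ∣ t) (f : ℕ → M) :
    ∑ d ∈ (p * t).divisors, f d = ∑ d ∈ t.divisors, f d + ∑ d ∈ t.divisors, f (p * d) := by
  have hcop : p.Coprime t := (hp.coprime_iff_not_dvd).mpr hpt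
  rw [hcop.divisors_mul, Finset.sum_map]
  refine (Finset.sum_attach _ fun c : ℕ × ℕ => f (c.1 * c.2)).trans ?_
  rw [Finset.sum_product, hp.sum_divisors]
  simp only [one_mul, add_comm]

section Indicator

variable {F : Type*} [Field F] [Fintype F]

/-- The Möbius-weighted sum of character sums over the divisors of `t`, proportional to the
indicator of `t`-free elements. -/
noncomputable def mobiusCharSum (t : ℕ) (x : F) : ℂ :=
  ∑ d ∈ t.divisors, (ArithmeticFunction.moebius d : ℂ) / (Nat.totient d : ℂ) * charSumOfOrder d x

lemma mobiusCharSum_prime_mul_of_dvd {p t : ℕ} (hp : p.Prime) (hpt : p ∣ t) (ht : t ≠ 0) (x : F) :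
    mobiusCharSum (p * t) x = mobiusCharSum t x := by
  symm
  refine Finset.sum_subset
    (Nat.divisors_subset_of_dvd (mul_ne_zero hp.ne_zero ht) (dvd_mul_left t p)) ?_
  intro d hd hdt
  have hd := Nat.dvd_of_mem_divisors hd
  have hdt : ¬d ∣ t := fun h => hdt (Nat.mem_divisors.mpr ⟨h, ht⟩)
  rw [ArithmeticFunction.moebius_eq_zero_of_not_squarefree]
  · simp
  intro hsq
  have hpd : p ∣ d := by
    by_contra hpd
    exact hdt (((hp.coprime_iff_not_dvd).mpr hpd).symm.dvd_of_dvd_mul_left hd)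
  obtain ⟨e, rfl⟩ := hpd
  have het : e ∣ t := Nat.dvd_of_mul_dvd_mul_left hp.pos hd
  have hpe : p.Coprime e := Nat.coprime_of_squarefree_mul hsq
  exact hdt (hpe.mul_dvd_of_dvd_of_dvd hpt het)

lemma moebius_div_totient_mul_charSumOfOrder_prime_mul {p d : ℕ} (hp : p.Prime) (hpd : ¬p ∣ d)
    (x : F) :
    (ArithmeticFunction.moebius (p * d) : ℂ) / (Nat.totient (p * d) : ℂ) *
        charSumOfOrder (p * d) x =
      -(charSumOfOrder p x / ((p : ℂ) - 1)) *
        ((ArithmeticFunction.moebius d : ℂ) / (Nat.totient d : ℂ) * charSumOfOrder d x) := by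
  have hcop : p.Coprime d := (hp.coprime_iff_not_dvd).mpr hpd
  rw [charSumOfOrder_mul hcop,
    ArithmeticFunction.isMultiplicative_moebius.map_mul_of_coprime hcop,
    ArithmeticFunction.moebius_apply_prime hp, Nat.totient_mul hcop, Nat.totient_prime hp]
  push_cast [hp.one_le]
  rw [mul_div_mul_comm]
  ring

lemma ite_isTFree_eq_mobiusCharSum {t : ℕ} (ht0 : t ≠ 0) (ht : t ∣ Fintype.card F - 1) (x : F) :
    (if IsTFree t x then (1 : ℂ) else 0) = (Nat.totient t : ℂ) / (t : ℂ) * mobiusCharSum t x := by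
  rcases eq_or_ne x 0 with rfl | hx
  · simp [IsTFree, mobiusCharSum, charSumOfOrder_zero_right]
  induction t using induction_on_primes with
  | zero => exact absurd rfl ht0
  | one => simp [isTFree_iff_forall_prime, hx, mobiusCharSum, charSumOfOrder_one hx,
      Nat.not_prime_one]
  | prime_mul p t hp ih =>
    have ht0' : t ≠ 0 := right_ne_zero_of_mul ht0
    have ih := ih ht0' (dvd_of_mul_left_dvd ht)
    have hp0 : (p : ℂ) ≠ 0 := Nat.cast_ne_zero.mpr hp.ne_zero
    have htc : (t : ℂ) ≠ 0 := Nat.cast_ne_zero.mpr ht0'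
    by_cases hpt : p ∣ t
    · have hiff : IsTFree (p * t) x ↔ IsTFree t x := by
        rw [isTFree_prime_mul hp, and_iff_left_iff_imp]
        exact fun h => (isTFree_iff_forall_prime.mp h).2 p hp hpt
      rw [mobiusCharSum_prime_mul_of_dvd hp hpt ht0', Nat.totient_mul_of_prime_of_dvd hp hpt]
      simp only [hiff, ih]
      push_cast
      rw [mul_div_mul_left _ _ hp0]
    · have hp1 : (p : ℂ) - 1 ≠ 0 := sub_ne_zero.mpr (Nat.cast_ne_one.mpr hp.ne_one)
      have hsum : mobiusCharSum (p * t) x =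
          (1 - charSumOfOrder p x / ((p : ℂ) - 1)) * mobiusCharSum t x := by
        rw [mobiusCharSum, hp.sum_divisors_mul_of_not_dvd hpt, sub_mul, one_mul, sub_eq_add_neg,
          ← neg_mul, mobiusCharSum, Finset.mul_sum]
        congr 1
        refine Finset.sum_congr rfl fun d hd => ?_
        exact moebius_div_totient_mul_charSumOfOrder_prime_mul hp
          (fun h => hpt (h.trans (Nat.dvd_of_mem_divisors hd))) x
      have hind : (if IsTFree (p * t) x then (1 : ℂ) else 0) =
          (if IsTFree t x then (1 : ℂ) else 0) * (if ∃ y : F, y ^ p = x then 0 else 1) := by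
        simp only [isTFree_prime_mul hp]
        split_ifs <;> first | (simp; done) | tauto
      rw [hind, ih, hsum, Nat.totient_mul ((hp.coprime_iff_not_dvd).mpr hpt),
        Nat.totient_prime hp, charSumOfOrder_prime hp (dvd_of_mul_right_dvd ht) hx]
      push_cast [hp.one_le]
      split_ifs <;> field_simp <;> ring

end Indicator

lemma Ncount_eq_sum {F : Type*} [Field F] [Fintype F] (a b c : F) {t : ℕ}
    (ht0 : t ≠ 0) (ht : t ∣ Fintype.card F - 1) (χ : MulChar F ℂ) :
    (Ncount F a b c t (orderOf χ) : ℂ) =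
      (Nat.totient t : ℂ) / ((orderOf χ : ℂ) * (t : ℂ)) *
        ∑ i ∈ Finset.range (orderOf χ), ∑ x : F,
          mobiusCharSum t x * (χ ^ i) (a * x ^ 2 + b * x + c) := by
  have hk : (orderOf χ : ℂ) ≠ 0 := Nat.cast_ne_zero.mpr (MulChar.orderOf_pos χ).ne'
  rw [Ncount, Nat.card_eq_card_toFinset, Set.toFinset_ofPred, Finset.card_filter,
    Finset.sum_comm, Finset.mul_sum]
  push_cast
  refine Finset.sum_congr rfl fun x _ => ?_
  rw [← Finset.mul_sum, MulChar.sum_range_orderOf_pow_apply, ite_and,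
    ← mul_boole, ite_isTFree_eq_mobiusCharSum ht0 ht]
  split_ifs
  · field_simp
  · simp

theorem Ncount_difference_character_expansion
    {F : Type*} [Field F] [Fintype F] {q k : ℕ} (hq : Fintype.card F = q)
    (hk : 2 ≤ k) (hkdvd : k ∣ q - 1)
    (a b c : F) (ha : a ≠ 0) (hdisc : b ^ 2 - 4 * a * c ≠ 0)
    (χk : MulChar F ℂ) (hχk : orderOf χk = k)
    {t : ℕ} (ht0 : 0 < t) (htdvd : t ∣ q - 1)
    {p : ℕ} (hp : p.Prime) (hpq : p ∣ q - 1) (hpt : ¬ p ∣ t) :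
    (Ncount F a b c (p * t) k : ℂ) - (1 - 1 / (p : ℂ)) * (Ncount F a b c t k : ℂ)
      = (Nat.totient (p * t) : ℂ) / ((k : ℂ) * (p : ℂ) * (t : ℂ)) *
          ∑ i ∈ Finset.range k, ∑ d ∈ t.divisors,
            ((ArithmeticFunction.moebius (p * d) : ℂ) / (Nat.totient (p * d) : ℂ)) *
              ∑ χ ∈ Finset.univ.filter (fun χ : MulChar F ℂ => orderOf χ = p * d),
                ∑ x : F, χ x * (χk ^ i) (a * x ^ 2 + b * x + c) := by
  subst hq hχk
  have hpt0 : p * t ≠ 0 := mul_ne_zero hp.ne_zero ht0.ne'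
  have hptq : p * t ∣ Fintype.card F - 1 :=
    ((hp.coprime_iff_not_dvd).mpr hpt).mul_dvd_of_dvd_of_dvd hpq htdvd
  have hp0 : (p : ℂ) ≠ 0 := Nat.cast_ne_zero.mpr hp.ne_zero
  have ht0' : (t : ℂ) ≠ 0 := Nat.cast_ne_zero.mpr ht0.ne'
  have hk0 : (orderOf χk : ℂ) ≠ 0 := Nat.cast_ne_zero.mpr (MulChar.orderOf_pos χk).ne'
  have hcoef : (1 - 1 / (p : ℂ)) * ((Nat.totient t : ℂ) / ((orderOf χk : ℂ) * (t : ℂ))) =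
      (Nat.totient (p * t) : ℂ) / ((orderOf χk : ℂ) * (p : ℂ) * (t : ℂ)) := by
    rw [Nat.totient_mul ((hp.coprime_iff_not_dvd).mpr hpt), Nat.totient_prime hp]
    push_cast [hp.one_le]
    field_simp
  rw [Ncount_eq_sum a b c hpt0 hptq, Ncount_eq_sum a b c ht0.ne' htdvd, ← mul_assoc, hcoef,
    Nat.cast_mul p t, ← mul_assoc (orderOf χk : ℂ), ← mul_sub, ← Finset.sum_sub_distrib]
  congr 1
  refine Finset.sum_congr rfl fun i _ => ?_
  rw [← Finset.sum_sub_distrib]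
  simp only [← sub_mul, mobiusCharSum, hp.sum_divisors_mul_of_not_dvd hpt, add_sub_cancel_left]
  simp only [charSumOfOrder, Finset.sum_mul, Finset.mul_sum, mul_assoc]
  rw [Finset.sum_comm]
  exact Finset.sum_congr rfl fun d _ => Finset.sum_comm
end
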